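/- arXiv:2108.01040 — 7 statements merged into one kernel-verified Lean document; each statement's English description precedes it below -/
import Mathlib

section
/- For every real number A > 1/2 there is a constant C(A) such that for all real x with |x| ≤ 1/2 and all v, y > 0: ∑_{m ∈ ℤ, m ≠ 0} (v(m+x)² + y)^{−A} ≤ C(A) · v^{−1/2} · (v+y)^{−A+1/2}. -/
/-- Summation by comparison with a telescoping sum: the exponent `-p` with `p > 1` is dominated by
the difference of the exponent `1 - p` at consecutive points. -/
lemma rpow_neg_le_rpow_sub_rpow {p a : ℝ} (hp : 1 < p) (ha : 1 < a) :
    (p - 1) * a ^ (-p) ≤ (a - 1) ^ (1 - p) - a ^ (1 - p) := by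
  have ha0 : 0 < a := by linarith
  have hb : 0 < 1 - 1 / a := by
    rw [sub_pos, div_lt_one ha0]; exact ha
  have hlog : Real.log (1 - 1 / a) ≤ -(1 / a) := by
    linarith [Real.log_le_sub_one_of_pos hb]
  have hbern : 1 + (p - 1) / a ≤ (1 - 1 / a) ^ (1 - p) := by
    rw [Real.rpow_def_of_pos hb]
    have h := Real.add_one_le_exp (Real.log (1 - 1 / a) * (1 - p))
    have h' : (p - 1) * (1 / a) ≤ (p - 1) * -Real.log (1 - 1 / a) :=
      mul_le_mul_of_nonneg_left (by linarith) (by linarith)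
    rw [mul_one_div] at h'
    linarith
  have hfac : (a - 1) ^ (1 - p) = a ^ (1 - p) * (1 - 1 / a) ^ (1 - p) := by
    rw [← Real.mul_rpow ha0.le hb.le]
    congr 1
    field_simp
  have hneg : a ^ (-p) = a ^ (1 - p) / a := by
    rw [← Real.rpow_sub_one ha0.ne']
    congr 1
    ring
  rw [hfac, hneg]
  have h := mul_le_mul_of_nonneg_left hbern (Real.rpow_nonneg ha0.le (1 - p))
  have e : a ^ (1 - p) * (1 + (p - 1) / a) = a ^ (1 - p) + (p - 1) * (a ^ (1 - p) / a) := by ring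
  linarith

/-- The consecutive differences of `t ↦ t ^ (1 - p)` along `R, R + 1, …` sum to `R ^ (1 - p)`. -/
lemma hasSum_rpow_sub_rpow {p R : ℝ} (hp : 1 < p) (hR : 0 < R) :
    HasSum (fun n : ℕ => ((n : ℝ) + R) ^ (1 - p) - ((n : ℝ) + 1 + R) ^ (1 - p)) (R ^ (1 - p)) := by
  rw [hasSum_iff_tendsto_nat_of_nonneg]
  · have hsum (N : ℕ) : ∑ n ∈ Finset.range N,
        (((n : ℝ) + R) ^ (1 - p) - ((n : ℝ) + 1 + R) ^ (1 - p)) =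
          R ^ (1 - p) - ((N : ℝ) + R) ^ (1 - p) := by
      have h := Finset.sum_range_sub' (fun n : ℕ => ((n : ℝ) + R) ^ (1 - p)) N
      simpa using h
    simp only [hsum]
    have hlim : Filter.Tendsto (fun N : ℕ => ((N : ℝ) + R) ^ (1 - p)) Filter.atTop (nhds 0) := by
      have h := (tendsto_rpow_neg_atTop (y := p - 1) (by linarith)).comp
        (Filter.tendsto_atTop_add_const_right _ R tendsto_natCast_atTop_atTop)
      simpa [Function.comp_def] using h
    simpa using hlim.const_sub (R ^ (1 - p))
  · intro n
    have hn : (0 : ℝ) ≤ n := n.cast_nonneg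
    exact sub_nonneg.2 <| Real.rpow_le_rpow_of_nonpos (by linarith) (by linarith) (by linarith)

/-- Over the nonzero integers, the same differences evaluated at `|m|` sum to `2 R ^ (1 - p)`. -/
lemma hasSum_int_ne_zero_rpow_sub_rpow {p R : ℝ} (hp : 1 < p) (hR : 0 < R) :
    HasSum (fun m : {m : ℤ // m ≠ 0} =>
      (|((m : ℤ) : ℝ)| - 1 + R) ^ (1 - p) - (|((m : ℤ) : ℝ)| + R) ^ (1 - p))
      (2 * R ^ (1 - p)) := by
  let f : ℤ → ℝ := fun m =>
    if m = 0 then 0 else (|(m : ℝ)| - 1 + R) ^ (1 - p) - (|(m : ℝ)| + R) ^ (1 - p)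
  have hpos : HasSum (fun n : ℕ => f n) (R ^ (1 - p)) := by
    have h0 : ∑ n ∈ Finset.range 1, f n = 0 := by simp [f]
    suffices h : HasSum (fun n : ℕ => f (n + 1 : ℕ)) (R ^ (1 - p)) by
      rw [← hasSum_nat_add_iff' 1, h0, sub_zero]
      exact h
    convert hasSum_rpow_sub_rpow hp hR using 2 with n
    have hn : ((n + 1 : ℕ) : ℤ) ≠ 0 := by omega
    have hn' : |(n : ℝ) + 1| = n + 1 := abs_of_nonneg (by positivity)
    simp only [f, if_neg hn]
    simp [hn']
  have hneg : HasSum (fun n : ℕ => f (-(n + 1))) (R ^ (1 - p)) := by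
    convert hasSum_rpow_sub_rpow hp hR using 2 with n
    have hn : -((n : ℤ) + 1) ≠ 0 := by omega
    have hn' : |-1 + -(n : ℝ)| = n + 1 := by
      rw [← neg_add, abs_neg, abs_of_nonneg (by positivity), add_comm]
    simp only [f, if_neg hn]
    simp [hn']
  have hint : HasSum f (2 * R ^ (1 - p)) := by
    rw [two_mul]
    exact hpos.of_nat_of_neg_add_one hneg
  have hsupp : Function.support f ⊆ {m : ℤ | m ≠ 0} := by
    intro m hm h0
    simp [f, h0] at hm
  have h := (hasSum_subtype_iff_of_support_subset hsupp).2 hint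
  have hf : f ∘ Subtype.val = fun m : {m : ℤ // m ≠ 0} =>
      (|((m : ℤ) : ℝ)| - 1 + R) ^ (1 - p) - (|((m : ℤ) : ℝ)| + R) ^ (1 - p) :=
    funext fun m => if_neg m.2
  exact hf ▸ h

/-- Lower bound for the shifted quadratic form at a nonzero integer. -/
lemma mul_sq_add_sqrt_le {x v y : ℝ} (hx : |x| ≤ 1 / 2) (hv : 0 < v) (hy : 0 < y)
    {m : ℤ} (hm : m ≠ 0) :
    v / 16 * (|(m : ℝ)| + √((v + y) / v)) ^ 2 ≤ v * ((m : ℝ) + x) ^ 2 + y := by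
  have hm1 : 1 ≤ |(m : ℝ)| := by exact_mod_cast Int.one_le_abs hm
  set R := √((v + y) / v) with hR
  have hRsq : v * R ^ 2 = v + y := by
    rw [hR, Real.sq_sqrt (by positivity)]
    field_simp
  have hhalf : |(m : ℝ)| / 2 ≤ |(m : ℝ) + x| := by
    have h := abs_sub_abs_le_abs_add (m : ℝ) x
    linarith
  have hsq : |(m : ℝ)| ^ 2 / 4 ≤ ((m : ℝ) + x) ^ 2 := by
    rw [← sq_abs ((m : ℝ) + x)]
    nlinarith
  have hadd : (|(m : ℝ)| + R) ^ 2 ≤ 2 * (|(m : ℝ)| ^ 2 + R ^ 2) := add_sq_le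
  have h1 := mul_le_mul_of_nonneg_left hsq hv.le
  have h2 := mul_le_mul_of_nonneg_left hadd hv.le
  have h3 : v * 1 ≤ v * |(m : ℝ)| ^ 2 :=
    mul_le_mul_of_nonneg_left (one_le_pow₀ hm1) hv.le
  linarith

/-- lemma on integer sums, part 1.
For every real `A > 1/2` there is a constant `C(A)` such that for all real `x` with
`|x| ≤ 1/2` and all `v, y > 0`:
`∑_{m ∈ ℤ, m ≠ 0} (v(m+x)² + y)^{−A} ≤ C(A) · v^{−1/2} · (v+y)^{−A+1/2}`. -/
theorem integer_sum_bound_one (A : ℝ) (hA : 1 / 2 < A) :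
    ∃ C : ℝ, ∀ x v y : ℝ, |x| ≤ 1 / 2 → 0 < v → 0 < y →
      ∑' m : {m : ℤ // m ≠ 0}, (v * ((m : ℤ) + x) ^ 2 + y) ^ (-A)
        ≤ C * v ^ (-(1 : ℝ) / 2) * (v + y) ^ (-A + 1 / 2) := by
  refine ⟨16 ^ A / (2 * A - 1) * 2, fun x v y hx hv hy => ?_⟩
  have hs : 0 < v + y := by linarith
  have hp : 1 < 2 * A := by linarith
  have hp0 : 0 < 2 * A - 1 := by linarith
  set R := √((v + y) / v) with hR
  have hR0 : 0 < R := Real.sqrt_pos.2 (by positivity)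
  have hsum := (hasSum_int_ne_zero_rpow_sub_rpow hp hR0).mul_left
    (16 ^ A * v ^ (-A) / (2 * A - 1))
  have hterm (m : {m : ℤ // m ≠ 0}) : (v * (((m : ℤ) : ℝ) + x) ^ 2 + y) ^ (-A) ≤
      16 ^ A * v ^ (-A) / (2 * A - 1) *
        ((|((m : ℤ) : ℝ)| - 1 + R) ^ (1 - 2 * A) - (|((m : ℤ) : ℝ)| + R) ^ (1 - 2 * A)) := by
    have hm1 : 1 ≤ |((m : ℤ) : ℝ)| := by exact_mod_cast Int.one_le_abs m.2
    have ha : 0 < |((m : ℤ) : ℝ)| + R := by linarith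
    have htel := rpow_neg_le_rpow_sub_rpow (a := |((m : ℤ) : ℝ)| + R) hp (by linarith)
    rw [add_sub_right_comm] at htel
    calc (v * (((m : ℤ) : ℝ) + x) ^ 2 + y) ^ (-A)
        ≤ (v / 16 * (|((m : ℤ) : ℝ)| + R) ^ 2) ^ (-A) :=
          Real.rpow_le_rpow_of_nonpos (by positivity) (mul_sq_add_sqrt_le hx hv hy m.2)
            (by linarith)
      _ = 16 ^ A * v ^ (-A) / (2 * A - 1) *
            ((2 * A - 1) * (|((m : ℤ) : ℝ)| + R) ^ (-(2 * A))) := by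
          rw [Real.mul_rpow (by positivity) (by positivity), Real.div_rpow hv.le (by norm_num),
            Real.rpow_neg (by norm_num : (0 : ℝ) ≤ 16), ← Real.rpow_natCast, ← Real.rpow_mul ha.le,
            Nat.cast_ofNat, mul_neg, ← mul_assoc, div_mul_cancel₀ _ hp0.ne']
          field_simp
      _ ≤ _ := mul_le_mul_of_nonneg_left htel (by positivity)
  have hsummable : Summable fun m : {m : ℤ // m ≠ 0} =>
      (v * (((m : ℤ) : ℝ) + x) ^ 2 + y) ^ (-A) :=
    Summable.of_nonneg_of_le (fun m => by positivity) hterm hsum.summable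
  refine (hasSum_le hterm hsummable.hasSum hsum).trans_eq ?_
  have hRpow : v ^ (-A) * R ^ (1 - 2 * A) = v ^ (-(1 : ℝ) / 2) * (v + y) ^ (-A + 1 / 2) := by
    rw [hR, Real.sqrt_eq_rpow, ← Real.rpow_mul (by positivity), Real.div_rpow hs.le hv.le,
      show 1 / 2 * (1 - 2 * A) = -A + 1 / 2 by ring,
      show (-(1 : ℝ) / 2) = -A - (-A + 1 / 2) by ring, Real.rpow_sub hv]
    ring
  linear_combination 16 ^ A / (2 * A - 1) * 2 * hRpow
end

section
/- There exists a smooth, nonnegative function f₁ : ℝ → ℝ whose support is a compact subset of the open interval (0,1), such that for every x ∈ ℝ: ∑_{j ≥ 0} ( f₁(2ʲ x) + f₁(2ʲ(1−x)) ) = χ_{(0,1)}(x), where χ_{(0,1)} is the indicator function of the open unit interval (0,1). In particular, for each x the sum has only finitely many nonzero terms, it equals 1 for 0 < x < 1, and it equals 0 for x ≤ 0 or x ≥ 1. -/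
/-- A smooth step from `0` on `(-∞, 1/3]` to `1` on `[2/3, ∞)`. -/
noncomputable def middleThirdStep (x : ℝ) : ℝ := Real.smoothTransition (3 * x - 1)

/-- The dyadic difference of `middleThirdStep`, supported in `[1/6, 2/3]`. -/
noncomputable def dyadicBump (x : ℝ) : ℝ := middleThirdStep (2 * x) - middleThirdStep x

theorem middleThirdStep_eq_zero {x : ℝ} (hx : x ≤ 1 / 3) : middleThirdStep x = 0 :=
  Real.smoothTransition.zero_of_nonpos (by linarith)

theorem middleThirdStep_eq_one {x : ℝ} (hx : 2 / 3 ≤ x) : middleThirdStep x = 1 :=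
  Real.smoothTransition.one_of_one_le (by linarith)

theorem middleThirdStep_add_one_sub (x : ℝ) :
    middleThirdStep x + middleThirdStep (1 - x) = 1 := by
  have h := (Real.smoothTransition.pos_denom (3 * x - 1)).ne'
  have e : 3 * (1 - x) - 1 = 1 - (3 * x - 1) := by ring
  rw [middleThirdStep, middleThirdStep, e, Real.smoothTransition, Real.smoothTransition,
    sub_sub_cancel, add_comm (expNegInvGlue (1 - (3 * x - 1))), ← add_div, div_self h]

theorem contDiff_middleThirdStep {n : ℕ∞} : ContDiff ℝ n middleThirdStep :=
  Real.smoothTransition.contDiff.comp (by fun_prop)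

theorem contDiff_dyadicBump {n : ℕ∞} : ContDiff ℝ n dyadicBump :=
  (contDiff_middleThirdStep.comp (by fun_prop)).sub contDiff_middleThirdStep

theorem dyadicBump_nonneg (x : ℝ) : 0 ≤ dyadicBump x := by
  rw [dyadicBump, sub_nonneg]
  rcases le_total x (1 / 3) with h | h
  · rw [middleThirdStep_eq_zero h]
    exact Real.smoothTransition.nonneg _
  · rw [middleThirdStep_eq_one (show 2 / 3 ≤ 2 * x by linarith)]
    exact Real.smoothTransition.le_one _

theorem dyadicBump_eq_zero_of_le {x : ℝ} (hx : x ≤ 1 / 6) : dyadicBump x = 0 := by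
  rw [dyadicBump, middleThirdStep_eq_zero (by linarith), middleThirdStep_eq_zero (by linarith),
    sub_zero]

theorem dyadicBump_eq_zero_of_ge {x : ℝ} (hx : 2 / 3 ≤ x) : dyadicBump x = 0 := by
  rw [dyadicBump, middleThirdStep_eq_one (by linarith), middleThirdStep_eq_one hx, sub_self]

theorem tsupport_dyadicBump_subset : tsupport dyadicBump ⊆ Set.Icc (1 / 6) (2 / 3) := by
  refine closure_minimal (fun x hx => ?_) isClosed_Icc
  by_contra h
  rw [Set.mem_Icc, not_and_or, not_le, not_le] at h
  exact hx (h.elim (fun h => dyadicBump_eq_zero_of_le h.le) fun h => dyadicBump_eq_zero_of_ge h.le)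

theorem sum_range_dyadicBump (x : ℝ) (n : ℕ) :
    ∑ j ∈ Finset.range n, dyadicBump (2 ^ j * x) =
      middleThirdStep (2 ^ n * x) - middleThirdStep x := by
  have h (j : ℕ) : dyadicBump (2 ^ j * x) =
      middleThirdStep (2 ^ (j + 1) * x) - middleThirdStep (2 ^ j * x) := by
    rw [dyadicBump, pow_succ', mul_assoc]
  simp_rw [h]
  rw [Finset.sum_range_sub (fun j => middleThirdStep (2 ^ j * x)), pow_zero, one_mul]

theorem dyadicBump_two_pow_mul_of_nonpos {x : ℝ} (hx : x ≤ 0) (j : ℕ) :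
    dyadicBump (2 ^ j * x) = 0 :=
  dyadicBump_eq_zero_of_le <|
    (mul_nonpos_of_nonneg_of_nonpos (by positivity) hx).trans (by norm_num)

theorem exists_forall_ge_two_pow_mul {x : ℝ} (hx : 0 < x) :
    ∃ n : ℕ, ∀ j ≥ n, 2 / 3 ≤ 2 ^ j * x := by
  obtain ⟨n, hn⟩ := pow_unbounded_of_one_lt (1 / x) (one_lt_two (α := ℝ))
  refine ⟨n, fun j hj => ?_⟩
  have h₁ : 1 < 2 ^ n * x := (div_lt_iff₀ hx).1 hn
  have h₂ : (2 : ℝ) ^ n * x ≤ 2 ^ j * x := by gcongr; norm_num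
  linarith

theorem finite_dyadicBump_ne_zero (x : ℝ) : {j : ℕ | dyadicBump (2 ^ j * x) ≠ 0}.Finite := by
  rcases le_or_gt x 0 with hx | hx
  · simp [dyadicBump_two_pow_mul_of_nonpos hx]
  · obtain ⟨n, hn⟩ := exists_forall_ge_two_pow_mul hx
    refine (Set.finite_Iio n).subset fun j hj => ?_
    by_contra h
    exact hj (dyadicBump_eq_zero_of_ge (hn j (not_lt.1 h)))

theorem hasSum_dyadicBump_of_nonpos {x : ℝ} (hx : x ≤ 0) :
    HasSum (fun j : ℕ => dyadicBump (2 ^ j * x)) 0 := by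
  simpa only [dyadicBump_two_pow_mul_of_nonpos hx] using hasSum_zero

theorem hasSum_dyadicBump_of_pos {x : ℝ} (hx : 0 < x) :
    HasSum (fun j : ℕ => dyadicBump (2 ^ j * x)) (1 - middleThirdStep x) := by
  obtain ⟨n, hn⟩ := exists_forall_ge_two_pow_mul hx
  rw [← middleThirdStep_eq_one (hn n le_rfl), ← sum_range_dyadicBump]
  exact hasSum_sum_of_ne_finset_zero fun j hj =>
    dyadicBump_eq_zero_of_ge (hn j (by simpa using hj))

theorem hasSum_dyadicBump_add (x : ℝ) :
    HasSum (fun j : ℕ => dyadicBump (2 ^ j * x) + dyadicBump (2 ^ j * (1 - x)))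
      (Set.indicator (Set.Ioo (0 : ℝ) 1) (fun _ => (1 : ℝ)) x) := by
  rcases le_or_gt x 0 with h₀ | h₀
  · rw [Set.indicator_of_notMem fun h => h₀.not_gt h.1]
    simpa [middleThirdStep_eq_one (show 2 / 3 ≤ 1 - x by linarith)] using
      (hasSum_dyadicBump_of_nonpos h₀).add
        (hasSum_dyadicBump_of_pos (show 0 < 1 - x by linarith))
  rcases le_or_gt 1 x with h₁ | h₁
  · rw [Set.indicator_of_notMem fun h => h₁.not_gt h.2]
    simpa [middleThirdStep_eq_one (show 2 / 3 ≤ x by linarith)] using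
      (hasSum_dyadicBump_of_pos h₀).add
        (hasSum_dyadicBump_of_nonpos (show 1 - x ≤ 0 by linarith))
  · rw [Set.indicator_of_mem (Set.mem_Ioo.2 ⟨h₀, h₁⟩)]
    convert (hasSum_dyadicBump_of_pos h₀).add
      (hasSum_dyadicBump_of_pos (show 0 < 1 - x by linarith)) using 1
    linarith [middleThirdStep_add_one_sub x]

/-- dyadic resolution of the sharp cutoff on `(0,1)`.
There is a smooth nonnegative function `f₁ : ℝ → ℝ`, compactly supported inside the open
interval `(0,1)`, such that for every `x ∈ ℝ` only finitely many terms of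
`∑_{j ≥ 0} (f₁(2ʲx) + f₁(2ʲ(1−x)))` are nonzero, and the sum equals the indicator
function of `(0,1)` at `x`. -/
theorem dyadic_cutoff_decomposition :
    ∃ f₁ : ℝ → ℝ, ContDiff ℝ (⊤ : ℕ∞) f₁ ∧ (∀ x, 0 ≤ f₁ x) ∧
      IsCompact (tsupport f₁) ∧ tsupport f₁ ⊆ Set.Ioo (0 : ℝ) 1 ∧
      ∀ x : ℝ,
        {j : ℕ | f₁ (2 ^ j * x) + f₁ (2 ^ j * (1 - x)) ≠ 0}.Finite ∧
        ∑' j : ℕ, (f₁ (2 ^ j * x) + f₁ (2 ^ j * (1 - x))) =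
          Set.indicator (Set.Ioo (0 : ℝ) 1) (fun _ => (1 : ℝ)) x := by
  refine ⟨dyadicBump, contDiff_dyadicBump, dyadicBump_nonneg,
    isCompact_Icc.of_isClosed_subset (isClosed_tsupport _) tsupport_dyadicBump_subset,
    tsupport_dyadicBump_subset.trans (Set.Icc_subset_Ioo (by norm_num) (by norm_num)),
    fun x => ⟨?_, (hasSum_dyadicBump_add x).tsum_eq⟩⟩
  refine ((finite_dyadicBump_ne_zero x).union (finite_dyadicBump_ne_zero (1 - x))).subset
    fun j hj => ?_
  by_contra h
  simp only [Set.mem_union, Set.mem_ofPred_eq, not_or, not_not] at h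
  exact hj (by rw [h.1, h.2, add_zero])
end

section
/- For every n ≥ 1 there is a constant C(n) such that for all R > 0: ∫⋯∫ over the region { (v₁,…,vₙ) ∈ (0,∞)ⁿ : v_j ≥ (3/4) v_{j+1} for 1 ≤ j ≤ n−1, and v₁ v₂ ⋯ vₙ ≥ R } of the integrand v₁^{−n−1} v₂^{−n} ⋯ vₙ^{−2} dv₁ dv₂ ⋯ dvₙ (i.e. with the factor v_j^{−(n−j+2)} for each j) is at most C(n) · R^{−(n+1)/2}. -/
open MeasureTheory

/-- The region `v_j ≥ (3/4) v_{j+1}` in the positive orthant with `v₀ ⋯ v_{d-1} v_d ^ m ≥ R`. -/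
def cuspRegion (d : ℕ) (m R : ℝ) : Set (Fin (d + 1) → ℝ) :=
  {v | (∀ i, 0 < v i) ∧ (∀ i : Fin d, (3 / 4 : ℝ) * v i.succ ≤ v i.castSucc) ∧
    R ≤ (∏ i : Fin d, v i.castSucc) * v (Fin.last d) ^ m}

/-- The product of powers `∏ v_j ^ (-(d - j + β))`. -/
noncomputable def cuspWeight (d : ℕ) (β : ℝ) (v : Fin (d + 1) → ℝ) : ℝ :=
  ∏ j : Fin (d + 1), v j ^ (-((d : ℝ) - (j : ℕ) + β))

lemma measurableSet_cuspRegion (d : ℕ) (m R : ℝ) : MeasurableSet (cuspRegion d m R) := by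
  have hpos : MeasurableSet {v : Fin (d + 1) → ℝ | ∀ i, 0 < v i} := by
    rw [Set.ofPred_forall]
    exact MeasurableSet.iInter fun i => measurableSet_lt (by fun_prop) (by fun_prop)
  have hle : MeasurableSet
      {v : Fin (d + 1) → ℝ | ∀ i : Fin d, (3 / 4 : ℝ) * v i.succ ≤ v i.castSucc} := by
    rw [Set.ofPred_forall]
    exact MeasurableSet.iInter fun i => measurableSet_le (by fun_prop) (by fun_prop)
  have hR : MeasurableSet
      {v : Fin (d + 1) → ℝ | R ≤ (∏ i : Fin d, v i.castSucc) * v (Fin.last d) ^ m} :=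
    measurableSet_le (by fun_prop) (by fun_prop)
  exact hpos.inter (hle.inter hR)

/-- Integrating out the last coordinate first. -/
lemma lintegral_fin_succ_le_lintegral_snoc (d : ℕ) (f : (Fin (d + 1) → ℝ) → ENNReal) :
    ∫⁻ v, f v ≤ ∫⁻ w : Fin d → ℝ, ∫⁻ x : ℝ, f (Fin.snoc w x) := by
  rw [← ((volume_preserving_piFinSuccAbove (fun _ : Fin (d + 1) => ℝ)
    (Fin.last d)).symm _).lintegral_comp_emb (MeasurableEquiv.measurableEmbedding _),
    Measure.volume_eq_prod, ← lintegral_prod_swap]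
  refine (lintegral_prod_le _).trans_eq ?_
  refine lintegral_congr fun w => lintegral_congr fun x => ?_
  congr 1
  exact Fin.insertNth_last' x w

lemma setLIntegral_Ici_rpow {β A : ℝ} (hβ : 1 < β) (hA : 0 < A) :
    ∫⁻ x in Set.Ici A, ENNReal.ofReal (x ^ (-β)) =
      ENNReal.ofReal (A ^ (-(β - 1)) / (β - 1)) := by
  rw [setLIntegral_congr Ioi_ae_eq_Ici.symm, ← ofReal_integral_eq_lintegral_ofReal
    (integrableOn_Ioi_rpow_of_lt (by linarith) hA), integral_Ioi_rpow_of_lt (by linarith) hA]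
  · rw [← neg_div_neg_eq]
    ring_nf
  · filter_upwards [ae_restrict_mem measurableSet_Ioi] with x hx
    exact Real.rpow_nonneg (hA.trans hx).le _

lemma lintegral_le_of_le_rpow_on {m β P R K : ℝ} (hm : 0 < m) (hβ : 1 < β) (hP : 0 < P)
    (hR : 0 < R) (hK : 0 ≤ K) {f : ℝ → ENNReal}
    (hf : ∀ x, f x ≠ 0 → 0 < x ∧ R ≤ P * x ^ m ∧ f x ≤ ENNReal.ofReal (K * x ^ (-β))) :
    ∫⁻ x, f x ≤ ENNReal.ofReal (K * ((R / P) ^ (-((β - 1) / m)) / (β - 1))) := by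
  have hA : 0 < (R / P) ^ (1 / m) := by positivity
  calc ∫⁻ x, f x ≤ ∫⁻ x, (Set.Ici ((R / P) ^ (1 / m))).indicator
        (fun x => ENNReal.ofReal K * ENNReal.ofReal (x ^ (-β))) x := by
        refine lintegral_mono fun x => ?_
        by_cases hx : f x = 0
        · simp [hx]
        obtain ⟨hx0, hRx, hle⟩ := hf x hx
        have hmem : x ∈ Set.Ici ((R / P) ^ (1 / m)) := by
          rw [Set.mem_Ici, one_div, Real.rpow_inv_le_iff_of_pos (by positivity) hx0.le hm,
            div_le_iff₀' hP]
          exact hRx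
        rwa [Set.indicator_of_mem hmem, ← ENNReal.ofReal_mul hK]
    _ = ENNReal.ofReal K * ∫⁻ x in Set.Ici ((R / P) ^ (1 / m)), ENNReal.ofReal (x ^ (-β)) := by
        rw [lintegral_indicator measurableSet_Ici, lintegral_const_mul' _ _ ENNReal.ofReal_ne_top]
    _ = _ := by
        rw [setLIntegral_Ici_rpow hβ hA, ← ENNReal.ofReal_mul hK, ← Real.rpow_mul (by positivity)]
        ring_nf

lemma cuspRegion_snoc {d : ℕ} {m R : ℝ} (hm : 0 < m) {w : Fin (d + 1) → ℝ} {x : ℝ}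
    (h : (Fin.snoc w x : Fin (d + 2) → ℝ) ∈ cuspRegion (d + 1) m R) :
    w ∈ cuspRegion d (m + 1) ((3 / 4) ^ m * R) ∧ 0 < x ∧ R ≤ (∏ i, w i) * x ^ m := by
  obtain ⟨hpos, hle, hR⟩ := h
  have hw : ∀ i, 0 < w i := fun i => by simpa using hpos i.castSucc
  have hx : 0 < x := by simpa using hpos (Fin.last _)
  have hxw : 3 / 4 * x ≤ w (Fin.last d) := by
    simpa [Fin.succ_last] using hle (Fin.last d)
  simp only [Fin.snoc_castSucc, Fin.snoc_last] at hR
  refine ⟨⟨hw, fun i => ?_, ?_⟩, hx, hR⟩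
  · have := hle i.castSucc
    rwa [Fin.succ_castSucc, Fin.snoc_castSucc, Fin.snoc_castSucc] at this
  · have hP : 0 < ∏ i, w i := Finset.prod_pos fun i _ => hw i
    calc (3 / 4) ^ m * R ≤ (3 / 4) ^ m * ((∏ i, w i) * x ^ m) := by gcongr
      _ = (∏ i, w i) * (3 / 4 * x) ^ m := by
        rw [Real.mul_rpow (by norm_num) hx.le]; ring
      _ ≤ (∏ i, w i) * w (Fin.last d) ^ m := by gcongr
      _ = _ := by
        rw [Fin.prod_univ_castSucc, Real.rpow_add (hw _), Real.rpow_one]; ring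

lemma cuspWeight_snoc (d : ℕ) (β : ℝ) (w : Fin (d + 1) → ℝ) (x : ℝ) :
    cuspWeight (d + 1) β (Fin.snoc w x) = cuspWeight d (β + 1) w * x ^ (-β) := by
  rw [cuspWeight, Fin.prod_univ_castSucc]
  simp only [Fin.snoc_castSucc, Fin.snoc_last, cuspWeight]
  congr 1
  · refine Finset.prod_congr rfl fun j _ => ?_
    push_cast
    simp only [Fin.val_castSucc]
    ring_nf
  · simp

lemma cuspWeight_mul_prod_rpow {d : ℕ} (β s : ℝ) {w : Fin (d + 1) → ℝ} (hw : ∀ i, 0 < w i) :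
    cuspWeight d β w * (∏ i, w i) ^ s = cuspWeight d (β - s) w := by
  rw [← Real.finsetProd_rpow _ _ fun i _ => (hw i).le, cuspWeight, ← Finset.prod_mul_distrib]
  refine Finset.prod_congr rfl fun j _ => ?_
  rw [← Real.rpow_add (hw j)]
  ring_nf

lemma exists_setLIntegral_cuspWeight_le (d : ℕ) (m β : ℝ) (hm : 1 ≤ m) (hβ : 1 < β) :
    ∃ C : ℝ, 0 ≤ C ∧ ∀ R : ℝ, 0 < R →
      ∫⁻ v in cuspRegion d m R, ENNReal.ofReal (cuspWeight d β v) ≤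
        ENNReal.ofReal (C * R ^ (-((d + 1) * (β - 1 + d / 2) / (m + d)))) := by
  have hm0 : 0 < m := by linarith
  have hβ1 : 0 < β - 1 := by linarith
  induction d generalizing m β with
  | zero =>
    refine ⟨1 / (β - 1), by positivity, fun R hR => ?_⟩
    rw [← lintegral_indicator (measurableSet_cuspRegion _ _ _)]
    refine (lintegral_fin_succ_le_lintegral_snoc 0 _).trans ?_
    have key : ∀ w : Fin 0 → ℝ, ∫⁻ x : ℝ, (cuspRegion 0 m R).indicator
        (fun v => ENNReal.ofReal (cuspWeight 0 β v)) (Fin.snoc w x) ≤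
        ENNReal.ofReal (1 * ((R / 1) ^ (-((β - 1) / m)) / (β - 1))) := by
      intro w
      refine lintegral_le_of_le_rpow_on hm0 hβ one_pos hR zero_le_one fun x hx => ?_
      have hmem := Set.mem_of_indicator_ne_zero hx
      rw [Set.indicator_of_mem hmem]
      obtain ⟨hpos, -, hRx⟩ := hmem
      refine ⟨by simpa [Fin.snoc] using hpos 0, by simpa [Fin.snoc] using hRx, ?_⟩
      simp [cuspWeight, Fin.snoc]
    refine (lintegral_mono key).trans_eq ?_
    rw [lintegral_const]
    simp [volume_pi]
    ring_nf
  | succ d ih =>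
    obtain ⟨C, hC0, hC⟩ := ih (m + 1) (β + 1 - (β - 1) / m) (by linarith)
      (by have := div_le_self hβ1.le hm; linarith) (by linarith)
      (by have := div_le_self hβ1.le hm; linarith)
    set γ : ℝ := (d + 1) * (β + 1 - (β - 1) / m - 1 + d / 2) / (m + 1 + d) with hγ
    refine ⟨1 / (β - 1) * (C * ((3 / 4) ^ m) ^ (-γ)), by positivity, fun R hR => ?_⟩
    rw [← lintegral_indicator (measurableSet_cuspRegion _ _ _)]
    refine (lintegral_fin_succ_le_lintegral_snoc _ _).trans ?_
    have key : ∀ w : Fin (d + 1) → ℝ, ∫⁻ x : ℝ, (cuspRegion (d + 1) m R).indicator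
        (fun v => ENNReal.ofReal (cuspWeight (d + 1) β v)) (Fin.snoc w x) ≤
        (cuspRegion d (m + 1) ((3 / 4) ^ m * R)).indicator
          (fun w => ENNReal.ofReal (R ^ (-((β - 1) / m)) / (β - 1)) *
            ENNReal.ofReal (cuspWeight d (β + 1 - (β - 1) / m) w)) w := by
      intro w
      by_cases hw : w ∈ cuspRegion d (m + 1) ((3 / 4) ^ m * R)
      · have hpos := hw.1
        have hP : 0 < ∏ i, w i := Finset.prod_pos fun i _ => hpos i
        have hK : 0 ≤ cuspWeight d (β + 1) w :=
          Finset.prod_nonneg fun i _ => Real.rpow_nonneg (hpos i).le _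
        rw [Set.indicator_of_mem hw, ← ENNReal.ofReal_mul (by positivity)]
        refine (lintegral_le_of_le_rpow_on hm0 hβ hP hR hK fun x hx => ?_).trans_eq ?_
        · have hmem := Set.mem_of_indicator_ne_zero hx
          obtain ⟨-, hx0, hRx⟩ := cuspRegion_snoc hm0 hmem
          rw [Set.indicator_of_mem hmem, cuspWeight_snoc]
          exact ⟨hx0, hRx, le_rfl⟩
        · rw [← cuspWeight_mul_prod_rpow _ _ hpos, Real.div_rpow hR.le hP.le,
            Real.rpow_neg hP.le, div_inv_eq_mul]
          ring_nf
      · rw [Set.indicator_of_notMem hw, nonpos_iff_eq_zero, lintegral_eq_zero_of_ae_eq_zero]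
        refine Filter.Eventually.of_forall fun x => ?_
        exact Set.indicator_of_notMem (fun h => hw (cuspRegion_snoc hm0 h).1) _
    refine (lintegral_mono key).trans ?_
    rw [lintegral_indicator (measurableSet_cuspRegion _ _ _),
      lintegral_const_mul' _ _ ENNReal.ofReal_ne_top]
    refine (mul_le_mul_right (hC _ (by positivity)) _).trans_eq ?_
    rw [← ENNReal.ofReal_mul (by positivity), Real.mul_rpow (by positivity) hR.le]
    have hexp : -(((d + 1 : ℕ) + 1) * (β - 1 + (d + 1 : ℕ) / 2) / (m + (d + 1 : ℕ))) =
        -((β - 1) / m) + -γ := by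
      have : m + 1 + d ≠ 0 := by positivity
      have : m + (d + 1) ≠ 0 := by positivity
      rw [hγ]
      push_cast
      field_simp
      ring
    rw [hexp, Real.rpow_add hR]
    ring_nf


open MeasureTheory

/-- key volume estimate, Lemma 5.1.
For every `n ≥ 1` there is `C(n)` such that for all `R > 0`, the integral over the region
`{v ∈ (0,∞)ⁿ : v_j ≥ (3/4)v_{j+1}, v₁⋯vₙ ≥ R}` of `∏_j v_j^{−(n−j+2)}` (Lebesgue measure)
is at most `C(n) · R^{−(n+1)/2}`. -/
theorem cusp_volume_bound (n : ℕ) (hn : 1 ≤ n) :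
    ∃ C : ℝ, ∀ R : ℝ, 0 < R →
      (∫⁻ v in {v : Fin n → ℝ | (∀ i, 0 < v i) ∧
            (∀ i : Fin n, ∀ h : (i : ℕ) + 1 < n, (3 / 4 : ℝ) * v ⟨(i : ℕ) + 1, h⟩ ≤ v i) ∧
            R ≤ ∏ i, v i},
          ENNReal.ofReal (∏ j : Fin n, v j ^ (-((n : ℤ) - (j : ℕ) + 1)))) ≤
        ENNReal.ofReal (C * R ^ (-((n : ℝ) + 1) / 2)) := by
  obtain ⟨d, rfl⟩ : ∃ d, n = d + 1 := ⟨n - 1, by omega⟩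
  obtain ⟨C, hC0, hC⟩ := exists_setLIntegral_cuspWeight_le d 1 2 le_rfl (by norm_num)
  refine ⟨C, fun R hR => ?_⟩
  have hset : {v : Fin (d + 1) → ℝ | (∀ i, 0 < v i) ∧
      (∀ i : Fin (d + 1), ∀ h : (i : ℕ) + 1 < d + 1,
        (3 / 4 : ℝ) * v ⟨(i : ℕ) + 1, h⟩ ≤ v i) ∧ R ≤ ∏ i, v i} = cuspRegion d 1 R := by
    ext v
    simp only [cuspRegion, Set.mem_ofPred_eq, Real.rpow_one, ← Fin.prod_univ_castSucc]
    refine and_congr_right fun _ => and_congr_left fun _ => ⟨fun h i => ?_, fun h i hi => ?_⟩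
    · exact h i.castSucc (by simp)
    · exact h ⟨i, by omega⟩
  rw [hset]
  calc _ = ∫⁻ v in cuspRegion d 1 R, ENNReal.ofReal (cuspWeight d 2 v) := by
        refine lintegral_congr fun v => ?_
        congr 1
        refine Finset.prod_congr rfl fun j _ => ?_
        rw [← Real.rpow_intCast]
        push_cast
        ring_nf
    _ ≤ _ := hC R hR
    _ = _ := by
        congr 3
        push_cast
        field_simp
        ring
end

section
/- Let γ₁ = ((A₁,B₁),(C₁,D₁)) and γ₂ = ((A₂,B₂),(C₂,D₂)) be elements of Sp(n,ℤ), written in n×n blocks. Then for every index i, the (i,i) entry of (C₁A₂ + D₁C₂)(C₁B₂ + D₁D₂)ᵀ is congruent modulo 2 to the (i,i) entry of C₁A₂B₂ᵀC₁ᵀ + D₁C₂D₂ᵀD₁ᵀ + C₁D₁ᵀ, and the (i,i) entry of (A₁A₂ + B₁C₂)(A₁B₂ + B₁D₂)ᵀ is congruent modulo 2 to the (i,i) entry of A₁A₂B₂ᵀA₁ᵀ + B₁C₂D₂ᵀB₁ᵀ + A₁B₁ᵀ. -/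
open Matrix

/-- If `A * Dᵀ - B * Cᵀ = 1`, the diagonal of `(P * A + Q * C) * (P * B + Q * D)ᵀ` is, modulo `2`,
the diagonal of `P * A * Bᵀ * Pᵀ + Q * C * Dᵀ * Qᵀ + P * Qᵀ`. -/
theorem diag_mul_transpose_modEq_two {m n : Type*} [Fintype n] [DecidableEq n]
    (P Q : Matrix m n ℤ) {A B C D : Matrix n n ℤ} (h : A * Dᵀ - B * Cᵀ = 1) (i : m) :
    ((P * A + Q * C) * (P * B + Q * D)ᵀ) i i ≡
      (P * A * Bᵀ * Pᵀ + Q * C * Dᵀ * Qᵀ + P * Qᵀ) i i [ZMOD 2] := by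
  have hAD : A * Dᵀ = 1 + B * Cᵀ := sub_eq_iff_eq_add.mp h
  have expand : (P * A + Q * C) * (P * B + Q * D)ᵀ =
      P * A * Bᵀ * Pᵀ + Q * C * Dᵀ * Qᵀ + P * Qᵀ +
        (P * (B * Cᵀ) * Qᵀ + (P * (B * Cᵀ) * Qᵀ)ᵀ) := by
    have cross : P * A * (Dᵀ * Qᵀ) = P * Qᵀ + P * (B * Cᵀ) * Qᵀ := by
      rw [← Matrix.mul_assoc, Matrix.mul_assoc P, hAD, Matrix.mul_add, Matrix.mul_one,
        Matrix.add_mul]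
    simp only [transpose_add, transpose_mul, transpose_transpose, Matrix.add_mul,
      Matrix.mul_add, cross]
    simp only [Matrix.mul_assoc]
    abel
  rw [expand, Matrix.add_apply _ (_ + _ᵀ), Matrix.add_apply _ _ᵀ, transpose_apply, ← two_mul]
  exact Int.modEq_iff_dvd.mpr ⟨-(P * (B * Cᵀ) * Qᵀ) i i, by simp⟩

/-- parity identities for products of integral symplectic matrices.
For `γ₁ = ((A₁,B₁),(C₁,D₁))`, `γ₂ = ((A₂,B₂),(C₂,D₂))` in `Sp(n,ℤ)` and every index `i`,
the `(i,i)` entry of `(C₁A₂ + D₁C₂)(C₁B₂ + D₁D₂)ᵀ` is congruent mod 2 to the `(i,i)` entry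
of `C₁A₂B₂ᵀC₁ᵀ + D₁C₂D₂ᵀD₁ᵀ + C₁D₁ᵀ`, and the `(i,i)` entry of
`(A₁A₂ + B₁C₂)(A₁B₂ + B₁D₂)ᵀ` is congruent mod 2 to the `(i,i)` entry of
`A₁A₂B₂ᵀA₁ᵀ + B₁C₂D₂ᵀB₁ᵀ + A₁B₁ᵀ`. -/
theorem symplectic_diagonal_parity (n : ℕ)
    (A₁ B₁ C₁ D₁ A₂ B₂ C₂ D₂ : Matrix (Fin n) (Fin n) ℤ)
    (h₁AB : A₁ * B₁ᵀ = B₁ * A₁ᵀ) (h₁CD : C₁ * D₁ᵀ = D₁ * C₁ᵀ)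
    (h₁AD : A₁ * D₁ᵀ - B₁ * C₁ᵀ = 1)
    (h₂AB : A₂ * B₂ᵀ = B₂ * A₂ᵀ) (h₂CD : C₂ * D₂ᵀ = D₂ * C₂ᵀ)
    (h₂AD : A₂ * D₂ᵀ - B₂ * C₂ᵀ = 1) :
    ∀ i : Fin n,
      ((C₁ * A₂ + D₁ * C₂) * (C₁ * B₂ + D₁ * D₂)ᵀ) i i ≡
        (C₁ * A₂ * B₂ᵀ * C₁ᵀ + D₁ * C₂ * D₂ᵀ * D₁ᵀ + C₁ * D₁ᵀ) i i [ZMOD 2] ∧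
      ((A₁ * A₂ + B₁ * C₂) * (A₁ * B₂ + B₁ * D₂)ᵀ) i i ≡
        (A₁ * A₂ * B₂ᵀ * A₁ᵀ + B₁ * C₂ * D₂ᵀ * B₁ᵀ + A₁ * B₁ᵀ) i i [ZMOD 2] := by
  exact fun i ↦ ⟨diag_mul_transpose_modEq_two C₁ D₁ h₂AD i,
    diag_mul_transpose_modEq_two A₁ B₁ h₂AD i⟩
end

section
/- Let g = ((A,B),(C,D)) ∈ Sp(n,ℝ), written in n×n blocks. Then: (i) C Cᵀ + D Dᵀ is symmetric positive definite; (ii) X := (A Cᵀ + B Dᵀ)(C Cᵀ + D Dᵀ)^{−1} is symmetric; (iii) setting Y := (C Cᵀ + D Dᵀ)^{−1} and letting F be the unique upper-triangular matrix with positive diagonal entries such that F Fᵀ = Y, the matrix Q := Fᵀ (D + iC) is unitary; and (iv) g = ((I,X),(0,I)) · ((F,0),(0,(Fᵀ)^{−1})) · k(Q), where k(Q) = ((Re Q, −Im Q),(Im Q, Re Q)). Moreover this Iwasawa decomposition is unique: X, F and Q are uniquely determined by g among decompositions of this form with X symmetric, F upper-triangular with positive diagonal, and Q unitary. -/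
open Matrix Complex

namespace Matrix

/-- A positive definite real matrix has an inverse of the form `F * Fᵀ` with `F` upper triangular
with positive diagonal. -/
theorem PosDef.exists_upperTriangular_mul_transpose_eq_inv {n : ℕ} {M : Matrix (Fin n) (Fin n) ℝ}
    (hM : M.PosDef) :
    ∃ F : Matrix (Fin n) (Fin n) ℝ, (∀ i j : Fin n, j < i → F i j = 0) ∧ (∀ i, 0 < F i i) ∧
      F * Fᵀ = M⁻¹ := by
  set L := LDL.lowerInv hM with hL
  set d := LDL.diagEntries hM
  have hLu : IsUnit L := isUnit_of_invertible L
  have hconj : diagonal d = L * M * Lᵀ := by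
    have h := LDL.diag_eq_lowerInv_conj hM
    rwa [conjTranspose_eq_transpose_of_trivial] at h
  have hdpos : ∀ i, 0 < d i := by
    have hpd : (diagonal d).PosDef := by
      have h := (hLu.posDef_star_right_conjugate_iff (x := M)).2 hM
      rwa [star_eq_conjTranspose, conjTranspose_eq_transpose_of_trivial, ← hconj] at h
    simpa [posDef_diagonal_iff] using hpd
  have hLdiag : ∀ i, L i i ≠ 0 := by
    have hdet : L.det ≠ 0 := ((isUnit_iff_isUnit_det L).1 hLu).ne_zero
    rw [det_of_isLowerTriangular L fun i j hij => LDL.lowerInv_triangular hM hij] at hdet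
    exact fun i => Finset.prod_ne_zero_iff.1 hdet i (Finset.mem_univ i)
  have hinv : M⁻¹ = Lᵀ * diagonal (fun i => (d i)⁻¹) * L := by
    have hdd : (diagonal d)⁻¹ = diagonal (fun i => (d i)⁻¹) := by
      refine inv_eq_left_inv ?_
      rw [diagonal_mul_diagonal, ← diagonal_one]
      congr 1
      ext i
      exact inv_mul_cancel₀ (hdpos i).ne'
    have hLT : IsUnit Lᵀ.det := by simpa using (isUnit_iff_isUnit_det L).1 hLu
    rw [← hdd, hconj, mul_inv_rev, mul_inv_rev, Matrix.mul_assoc, Matrix.mul_assoc,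
      Matrix.mul_assoc, nonsing_inv_mul _ ((isUnit_iff_isUnit_det L).1 hLu), Matrix.mul_one,
      mul_nonsing_inv_cancel_left _ _ hLT]
  let e : Fin n → ℝ := fun i => SignType.sign (L i i) * (Real.sqrt (d i))⁻¹
  have he : ∀ i, e i * e i = (d i)⁻¹ := fun i => by
    have hs : (SignType.sign (L i i) : ℝ) * SignType.sign (L i i) = 1 := by
      rcases (hLdiag i).lt_or_gt with h | h <;> simp [h]
    calc e i * e i = (SignType.sign (L i i) : ℝ) * SignType.sign (L i i) *
          (Real.sqrt (d i) * Real.sqrt (d i))⁻¹ := by simp only [e, mul_inv]; ring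
      _ = (d i)⁻¹ := by rw [hs, one_mul, Real.mul_self_sqrt (hdpos i).le]
  refine ⟨Lᵀ * diagonal e, fun i j hij => ?_, fun i => ?_, ?_⟩
  · rw [mul_diagonal, transpose_apply, hL, LDL.lowerInv_triangular hM hij, zero_mul]
  · rw [mul_diagonal, transpose_apply]
    have : L i i * e i = |L i i| * (Real.sqrt (d i))⁻¹ := by
      rw [← self_mul_sign (L i i), mul_assoc]
    rw [this]
    exact mul_pos (abs_pos.2 (hLdiag i)) (inv_pos.2 (Real.sqrt_pos.2 (hdpos i)))
  · rw [transpose_mul, transpose_transpose, diagonal_transpose, hinv, Matrix.mul_assoc,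
      ← Matrix.mul_assoc (diagonal e), diagonal_mul_diagonal, ← Matrix.mul_assoc]
    simp only [he]

/-- An upper triangular `F` with positive diagonal is determined by `F * Fᵀ`. -/
theorem upperTriangular_eq_of_mul_transpose_eq {n : ℕ} {F G : Matrix (Fin n) (Fin n) ℝ}
    (hF : ∀ i j : Fin n, j < i → F i j = 0) (hFpos : ∀ i, 0 < F i i)
    (hG : ∀ i j : Fin n, j < i → G i j = 0) (hGpos : ∀ i, 0 < G i i)
    (h : F * Fᵀ = G * Gᵀ) : F = G := by
  have hdet : IsUnit G.det := by
    rw [det_of_isUpperTriangular (M := G) fun i j hij => hG i j hij]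
    exact (Finset.prod_pos fun i _ => hGpos i).ne'.isUnit
  have hdetT : IsUnit Gᵀ.det := by rwa [det_transpose]
  have : Invertible G := invertibleOfIsUnitDet G hdet
  set T := G⁻¹ * F with hT
  have hTT : T * Tᵀ = 1 := by
    rw [hT, transpose_mul, Matrix.mul_assoc, ← Matrix.mul_assoc F, h, transpose_nonsing_inv,
      Matrix.mul_assoc, mul_nonsing_inv _ hdetT, Matrix.mul_one, nonsing_inv_mul _ hdet]
  have : Invertible T := invertibleOfRightInverse T Tᵀ hTT
  have hGtri : G.BlockTriangular id := fun i j hij => hG i j hij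
  have hTtri : T.BlockTriangular id :=
    (blockTriangular_inv_of_blockTriangular hGtri).mul fun i j hij => hF i j hij
  have hTTtri : Tᵀ.BlockTriangular id := by
    rw [← inv_eq_right_inv hTT]
    exact blockTriangular_inv_of_blockTriangular hTtri
  have hoff : ∀ i j, i ≠ j → T i j = 0 := fun i j hij => by
    rcases hij.lt_or_gt with hlt | hlt
    · exact hTTtri hlt
    · exact hTtri hlt
  have hTdiag : T = diagonal fun i => T i i := by
    ext i j
    by_cases hij : i = j
    · subst hij; simp
    · rw [hoff i j hij, diagonal_apply_ne _ hij]
  have hFG : F = G * T := by rw [hT, mul_nonsing_inv_cancel_left _ _ hdet]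
  have hTone : ∀ i, T i i = 1 := fun i => by
    have hsq : T i i * T i i = 1 := by
      have := congrFun (congrFun hTT i) i
      rw [hTdiag, diagonal_transpose, diagonal_mul_diagonal] at this
      simpa using this
    have hp : 0 < G i i * T i i := by
      have := hFpos i
      rwa [hFG, hTdiag, mul_diagonal] at this
    have hTpos : 0 < T i i := (mul_pos_iff_of_pos_left (hGpos i)).1 hp
    nlinarith
  rw [hFG, hTdiag]
  simp [hTone]

/-- Unitarity of a complex matrix in terms of its real and imaginary parts. -/
theorem mul_conjTranspose_eq_one_iff {ι : Type*} [Fintype ι] [DecidableEq ι] (Q : Matrix ι ι ℂ) :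
    Q * Qᴴ = 1 ↔
      Q.map re * (Q.map re)ᵀ + Q.map im * (Q.map im)ᵀ = 1 ∧
        Q.map im * (Q.map re)ᵀ = Q.map re * (Q.map im)ᵀ := by
  have hre : ∀ i j, ((Q * Qᴴ) i j).re =
      (Q.map re * (Q.map re)ᵀ + Q.map im * (Q.map im)ᵀ) i j := fun i j => by
    simp [mul_apply, Finset.sum_add_distrib]
  have him : ∀ i j, ((Q * Qᴴ) i j).im =
      (Q.map im * (Q.map re)ᵀ) i j - (Q.map re * (Q.map im)ᵀ) i j := fun i j => by
    simp [mul_apply, Finset.sum_add_distrib]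
    ring
  have hone : ∀ i j, ((1 : Matrix ι ι ℂ) i j).re = (1 : Matrix ι ι ℝ) i j ∧
      ((1 : Matrix ι ι ℂ) i j).im = 0 := fun i j => by
    by_cases hij : i = j <;> simp [one_apply, hij]
  constructor
  · intro h
    constructor
    · ext i j
      rw [← hre, h, (hone i j).1]
    · ext i j
      rw [← sub_eq_zero, ← him, h, (hone i j).2]
  · rintro ⟨h₁, h₂⟩
    ext i j
    apply Complex.ext
    · rw [hre, h₁, (hone i j).1]
    · rw [him, h₂, sub_self, (hone i j).2]

/-- The other one-sided unitarity relation, in terms of real and imaginary parts. -/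
theorem map_re_map_im_relations {ι : Type*} [Fintype ι] [DecidableEq ι] {Q : Matrix ι ι ℂ}
    (hQ : Q * Qᴴ = 1) :
    (Q.map re)ᵀ * Q.map re + (Q.map im)ᵀ * Q.map im = 1 ∧
      (Q.map im)ᵀ * Q.map re = (Q.map re)ᵀ * Q.map im := by
  have h : Qᴴ * Qᴴᴴ = 1 := by rw [conjTranspose_conjTranspose, mul_eq_one_comm, hQ]
  have hr : Qᴴ.map re = (Q.map re)ᵀ := by ext; simp
  have hi : Qᴴ.map im = -(Q.map im)ᵀ := by ext; simp
  rw [mul_conjTranspose_eq_one_iff, hr, hi] at h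
  simpa using h

section RealImaginaryParts

variable {ι : Type*} [Fintype ι] (F C D : Matrix ι ι ℝ)

theorem map_re_ofReal_mul_add_I_smul :
    (F.map ofReal * (D.map ofReal + I • C.map ofReal)).map re = F * D := by
  ext i j
  simp [mul_apply]

theorem map_im_ofReal_mul_add_I_smul :
    (F.map ofReal * (D.map ofReal + I • C.map ofReal)).map im = F * C := by
  ext i j
  simp [mul_apply]

end RealImaginaryParts

/-- If the lower blocks `C`, `D` of a symplectic matrix come from `F` and a unitary matrix with
real part `P` and imaginary part `S`, and `E`, `G` satisfy the symplectic relations against them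
together with `E * Cᵀ + G * Dᵀ = 0`, then `E = F * P` and `G = -(F * S)`. -/
theorem eq_mul_and_eq_neg_mul_of_relations {ι : Type*} [Fintype ι] [DecidableEq ι]
    {F C D E G : Matrix ι ι ℝ}
    (h₁ : (Fᵀ * D)ᵀ * (Fᵀ * D) + (Fᵀ * C)ᵀ * (Fᵀ * C) = 1)
    (h₂ : (Fᵀ * C)ᵀ * (Fᵀ * D) = (Fᵀ * D)ᵀ * (Fᵀ * C))
    (h₃ : E * Cᵀ + G * Dᵀ = 0) (h₄ : E * Dᵀ - G * Cᵀ = 1) :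
    E = F * (Fᵀ * D) ∧ G = -(F * (Fᵀ * C)) := by
  simp only [transpose_mul, transpose_transpose, Matrix.mul_assoc] at h₁ h₂
  have hGD : G * Dᵀ = -(E * Cᵀ) := (neg_eq_of_add_eq_zero_right h₃).symm
  have hED : E * Dᵀ = 1 + G * Cᵀ := eq_add_of_sub_eq h₄
  have hGC : G * Cᵀ = E * Dᵀ - 1 := by rw [hED]; abel
  constructor
  · calc E = E * (Dᵀ * (F * (Fᵀ * D)) + Cᵀ * (F * (Fᵀ * C))) := by rw [h₁, Matrix.mul_one]
      _ = E * Dᵀ * (F * (Fᵀ * D)) + E * Cᵀ * (F * (Fᵀ * C)) := by noncomm_ring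
      _ = F * (Fᵀ * D) + G * (Cᵀ * (F * (Fᵀ * D))) - G * Dᵀ * (F * (Fᵀ * C)) := by
        rw [hED, hGD]; noncomm_ring
      _ = F * (Fᵀ * D) := by rw [h₂]; noncomm_ring
  · calc G = G * (Dᵀ * (F * (Fᵀ * D)) + Cᵀ * (F * (Fᵀ * C))) := by rw [h₁, Matrix.mul_one]
      _ = G * Dᵀ * (F * (Fᵀ * D)) + G * Cᵀ * (F * (Fᵀ * C)) := by noncomm_ring
      _ = -(F * (Fᵀ * C)) - E * (Cᵀ * (F * (Fᵀ * D))) + E * Dᵀ * (F * (Fᵀ * C)) := by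
        rw [hGC, hGD]; noncomm_ring
      _ = -(F * (Fᵀ * C)) := by rw [h₂]; noncomm_ring

/-- For a symplectic matrix with lower blocks `C`, `D`, the matrix `C * Cᵀ + D * Dᵀ` is positive
definite. -/
theorem posDef_mul_transpose_add_mul_transpose {ι : Type*} [Fintype ι] [DecidableEq ι]
    {A B C D : Matrix ι ι ℝ} (hAD : A * Dᵀ - B * Cᵀ = 1) : (C * Cᵀ + D * Dᵀ).PosDef := by
  have h : D * Aᵀ - C * Bᵀ = 1 := by
    simpa using congrArg transpose hAD
  have hN : fromCols C D * (fromCols C D)ᴴ = C * Cᵀ + D * Dᵀ := by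
    rw [conjTranspose_fromCols_eq_fromRows_conjTranspose, fromCols_mul_fromRows,
      conjTranspose_eq_transpose_of_trivial, conjTranspose_eq_transpose_of_trivial]
  rw [← hN]
  refine PosDef.mul_conjTranspose_self _ fun v w hvw => ?_
  have hr : fromCols C D * fromRows (-Bᵀ) Aᵀ = 1 := by
    rw [fromCols_mul_fromRows, ← h]
    noncomm_ring
  have := congrArg (· ᵥ* fromRows (-Bᵀ) Aᵀ) hvw
  simpa only [vecMul_vecMul, hr, vecMul_one] using this

end Matrix

/-- Iwasawa decomposition of `Sp(n,ℝ)` with respect to `U(n)`.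
For `g = ((A,B),(C,D)) ∈ Sp(n,ℝ)`: `CCᵀ + DDᵀ` is symmetric positive definite;
`X := (ACᵀ + BDᵀ)(CCᵀ + DDᵀ)⁻¹` is symmetric; there is a (unique) upper-triangular `F`
with positive diagonal such that `FFᵀ = Y := (CCᵀ + DDᵀ)⁻¹`, the matrix
`Q := Fᵀ(D + iC)` is unitary, and `g = ((I,X),(0,I))·((F,0),(0,(Fᵀ)⁻¹))·k(Q)`
(expressed blockwise); moreover `X`, `F`, `Q` are unique among such decompositions. -/
theorem symplectic_iwasawa_decomposition (n : ℕ)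
    (A B C D : Matrix (Fin n) (Fin n) ℝ)
    (hAB : A * Bᵀ = B * Aᵀ) (hCD : C * Dᵀ = D * Cᵀ) (hAD : A * Dᵀ - B * Cᵀ = 1) :
    (C * Cᵀ + D * Dᵀ).PosDef ∧
    ((A * Cᵀ + B * Dᵀ) * (C * Cᵀ + D * Dᵀ)⁻¹)ᵀ =
      (A * Cᵀ + B * Dᵀ) * (C * Cᵀ + D * Dᵀ)⁻¹ ∧
    ∃ F : Matrix (Fin n) (Fin n) ℝ,
      (∀ i j : Fin n, (j : ℕ) < (i : ℕ) → F i j = 0) ∧ (∀ i, 0 < F i i) ∧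
      F * Fᵀ = (C * Cᵀ + D * Dᵀ)⁻¹ ∧
      (Fᵀ.map ofReal * (D.map ofReal + Complex.I • C.map ofReal)) *
        (Fᵀ.map ofReal * (D.map ofReal + Complex.I • C.map ofReal))ᴴ = 1 ∧
      (A = F * (Fᵀ.map ofReal * (D.map ofReal + Complex.I • C.map ofReal)).map Complex.re +
          ((A * Cᵀ + B * Dᵀ) * (C * Cᵀ + D * Dᵀ)⁻¹) * (Fᵀ)⁻¹ *
            (Fᵀ.map ofReal * (D.map ofReal + Complex.I • C.map ofReal)).map Complex.im) ∧
      (B = -(F * (Fᵀ.map ofReal * (D.map ofReal + Complex.I • C.map ofReal)).map Complex.im) +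
          ((A * Cᵀ + B * Dᵀ) * (C * Cᵀ + D * Dᵀ)⁻¹) * (Fᵀ)⁻¹ *
            (Fᵀ.map ofReal * (D.map ofReal + Complex.I • C.map ofReal)).map Complex.re) ∧
      (C = (Fᵀ)⁻¹ *
        (Fᵀ.map ofReal * (D.map ofReal + Complex.I • C.map ofReal)).map Complex.im) ∧
      (D = (Fᵀ)⁻¹ *
        (Fᵀ.map ofReal * (D.map ofReal + Complex.I • C.map ofReal)).map Complex.re) ∧
      ∀ (X' F' : Matrix (Fin n) (Fin n) ℝ) (Q' : Matrix (Fin n) (Fin n) ℂ),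
        X'ᵀ = X' →
        (∀ i j : Fin n, (j : ℕ) < (i : ℕ) → F' i j = 0) → (∀ i, 0 < F' i i) →
        Q' * Q'ᴴ = 1 →
        A = F' * Q'.map Complex.re + X' * (F'ᵀ)⁻¹ * Q'.map Complex.im →
        B = -(F' * Q'.map Complex.im) + X' * (F'ᵀ)⁻¹ * Q'.map Complex.re →
        C = (F'ᵀ)⁻¹ * Q'.map Complex.im →
        D = (F'ᵀ)⁻¹ * Q'.map Complex.re →
        X' = (A * Cᵀ + B * Dᵀ) * (C * Cᵀ + D * Dᵀ)⁻¹ ∧ F' = F ∧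
          Q' = Fᵀ.map ofReal * (D.map ofReal + Complex.I • C.map ofReal) := by
  have hM := posDef_mul_transpose_add_mul_transpose hAD
  obtain ⟨F, hFtri, hFpos, hF⟩ := hM.exists_upperTriangular_mul_transpose_eq_inv
  set M := C * Cᵀ + D * Dᵀ with hMdef
  set W := A * Cᵀ + B * Dᵀ with hW
  have hMu : IsUnit M.det := (isUnit_iff_isUnit_det M).1 hM.isUnit
  have det_ne : ∀ G : Matrix (Fin n) (Fin n) ℝ, (∀ i j : Fin n, j < i → G i j = 0) →
      (∀ i, 0 < G i i) → IsUnit G.det := fun G h₁ h₂ => by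
    rw [det_of_isUpperTriangular (M := G) fun i j hij => h₁ i j hij]
    exact (Finset.prod_pos fun i _ => h₂ i).ne'.isUnit
  have hFu : IsUnit F.det := det_ne F hFtri hFpos
  have hFTu : IsUnit Fᵀ.det := by rwa [det_transpose]
  have hFMF : Fᵀ * M * F = 1 := by
    rw [Matrix.mul_assoc, mul_eq_one_comm, Matrix.mul_assoc, hF, mul_nonsing_inv _ hMu]
  have hFFM : F * (Fᵀ * M) = 1 := by
    rw [← Matrix.mul_assoc, hF, nonsing_inv_mul _ hMu]
  have hMFF : M * (F * Fᵀ) = 1 := by rw [hF, mul_nonsing_inv _ hMu]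
  have hQ : (Fᵀ.map ofReal * (D.map ofReal + Complex.I • C.map ofReal)) *
      (Fᵀ.map ofReal * (D.map ofReal + Complex.I • C.map ofReal))ᴴ = 1 := by
    rw [mul_conjTranspose_eq_one_iff, map_re_ofReal_mul_add_I_smul, map_im_ofReal_mul_add_I_smul]
    simp only [transpose_mul, transpose_transpose]
    constructor
    · rw [← hFMF, hMdef]
      noncomm_ring
    · calc Fᵀ * C * (Dᵀ * F) = Fᵀ * (C * Dᵀ) * F := by noncomm_ring
        _ = Fᵀ * D * (Cᵀ * F) := by rw [hCD]; noncomm_ring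
  have hrel := map_re_map_im_relations hQ
  rw [map_re_ofReal_mul_add_I_smul, map_im_ofReal_mul_add_I_smul] at hrel
  set X := W * M⁻¹ with hX
  have hXM : X * M = W := nonsing_inv_mul_cancel_right _ _ hMu
  have hEG : A - X * C = F * (Fᵀ * D) ∧ B - X * D = -(F * (Fᵀ * C)) := by
    refine eq_mul_and_eq_neg_mul_of_relations hrel.1 hrel.2 ?_ ?_
    · calc (A - X * C) * Cᵀ + (B - X * D) * Dᵀ = W - X * M := by
            rw [hW, hMdef]; noncomm_ring
        _ = 0 := by rw [hXM, sub_self]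
    · calc (A - X * C) * Dᵀ - (B - X * D) * Cᵀ
          = A * Dᵀ - B * Cᵀ - X * (C * Dᵀ - D * Cᵀ) := by noncomm_ring
        _ = 1 := by rw [hAD, hCD, sub_self, Matrix.mul_zero, sub_zero]
  have hA : A = F * (Fᵀ * D) + X * C := eq_add_of_sub_eq hEG.1
  have hB : B = -(F * (Fᵀ * C)) + X * D := eq_add_of_sub_eq hEG.2
  have hXsymm : Xᵀ = X := by
    have h : A * Bᵀ - B * Aᵀ = Xᵀ - X := by
      have e : A * Bᵀ - B * Aᵀ =
          F * Fᵀ * (C * Dᵀ - D * Cᵀ) * (F * Fᵀ) + F * (Fᵀ * M) * Xᵀ - X * (M * (F * Fᵀ)) +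
            X * (C * Dᵀ - D * Cᵀ) * Xᵀ := by
        rw [hA, hB, hMdef]
        simp only [transpose_add, transpose_neg, transpose_mul, transpose_transpose]
        noncomm_ring
      rw [e, hFFM, hMFF, hCD]
      simp
    rw [hAB, sub_self] at h
    exact (sub_eq_zero.1 h.symm)
  refine ⟨hM, hXsymm, F, hFtri, hFpos, hF, hQ, ?_⟩
  rw [map_re_ofReal_mul_add_I_smul, map_im_ofReal_mul_add_I_smul, Matrix.mul_assoc X,
    Matrix.mul_assoc X, nonsing_inv_mul_cancel_left _ _ hFTu, nonsing_inv_mul_cancel_left _ _ hFTu]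
  refine ⟨hA, hB, rfl, rfl, ?_⟩
  intro X' F' Q' _ hF'tri hF'pos hQ' hA' hB' hC' hD'
  have hF'u : IsUnit F'.det := det_ne F' hF'tri hF'pos
  have hF'Tu : IsUnit F'ᵀ.det := by rwa [det_transpose]
  have hS : Q'.map im = F'ᵀ * C := by rw [hC', mul_nonsing_inv_cancel_left _ _ hF'Tu]
  have hP : Q'.map re = F'ᵀ * D := by rw [hD', mul_nonsing_inv_cancel_left _ _ hF'Tu]
  rw [mul_conjTranspose_eq_one_iff, hS, hP] at hQ'
  simp only [transpose_mul, transpose_transpose] at hQ'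
  have hF'M : F'ᵀ * M * F' = 1 := by
    rw [← hQ'.1, hMdef]
    noncomm_ring
  have hF' : F' * F'ᵀ = M⁻¹ := by
    refine (inv_eq_left_inv ?_).symm
    rw [Matrix.mul_assoc, mul_eq_one_comm, hF'M]
  have hFF' : F' = F :=
    upperTriangular_eq_of_mul_transpose_eq hF'tri hF'pos hFtri hFpos (hF'.trans hF.symm)
  subst hFF'
  refine ⟨?_, rfl, ?_⟩
  · rw [hS, hP, Matrix.mul_assoc X', nonsing_inv_mul_cancel_left _ _ hF'Tu] at hA' hB'
    have hXW : X' * M = W := by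
      calc X' * M = X' * M + F' * F'ᵀ * (D * Cᵀ - C * Dᵀ) := by rw [hCD]; simp
        _ = (F' * (F'ᵀ * D) + X' * C) * Cᵀ + (-(F' * (F'ᵀ * C)) + X' * D) * Dᵀ := by
          rw [hMdef]; noncomm_ring
        _ = W := by rw [hW, ← hA', ← hB']
    rw [hX, ← hXW, mul_nonsing_inv_cancel_right _ _ hMu]
  · ext i j
    apply Complex.ext
    · exact congrFun (congrFun (hP.trans (map_re_ofReal_mul_add_I_smul _ C D).symm) i) j
    · exact congrFun (congrFun (hS.trans (map_im_ofReal_mul_add_I_smul _ C D).symm) i) j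
end

section
/- Let n ≥ 1, A > n/2, and c > 0. Let V = diag(v₁,…,vₙ) be a positive diagonal matrix with vₙ ≥ √3/2 and v_j ≥ (3/4) v_{j+1} for 1 ≤ j ≤ n−1, and let Y be a real symmetric positive definite n×n matrix satisfying w Y wᵀ ≥ c · w V wᵀ for all row vectors w ∈ ℝⁿ. Then there is a constant C = C(n, A, c), independent of V, Y and x, such that for every x ∈ ℝⁿ with all entries of absolute value at most 1/2: ∑_{m ∈ ℤⁿ, m₁ ≠ 0} ( 1 + (m+x) Y (m+x)ᵀ )^{−A} ≤ C · (v₁ v₂ ⋯ vₙ)^{−1/2} · (1 + v₁)^{−A + n/2}, where m₁ denotes the first coordinate of m. -/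
open Matrix MeasureTheory

/-- Comparison of a lattice sum with an integral: `∑ (1 + r (k + x)²)^(-s) ≪ r^(-1/2)` for
`s > 1/2`, uniformly in `0 < r ≤ R` and `|x| ≤ 1/2`. -/
theorem exists_sum_one_add_mul_sq_rpow_neg_le (s R : ℝ) (hs : 1 / 2 < s) :
    ∃ C : ℝ, ∀ r x : ℝ, 0 < r → r ≤ R → |x| ≤ 1 / 2 → ∀ F : Finset ℤ,
      ∑ k ∈ F, (1 + r * ((k : ℝ) + x) ^ 2) ^ (-s) ≤ C * r ^ (-(1 : ℝ) / 2) := by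
  have hint : Integrable (fun t : ℝ => (1 + t ^ 2) ^ (-s)) := by
    have h := integrable_rpow_neg_one_add_norm_sq (E := ℝ) (μ := volume) (r := 2 * s)
      (by simp; linarith)
    refine h.congr (Filter.Eventually.of_forall fun t => ?_)
    simp only [Real.norm_eq_abs, sq_abs]
    congr 1
    ring
  set K : ℝ := 2 + 5 * R with hK
  refine ⟨K ^ s * ∫ t : ℝ, (1 + t ^ 2) ^ (-s), fun r x hr hrR hx F => ?_⟩
  have hsq : 0 < √r := Real.sqrt_pos.2 hr
  have hfun : (fun t : ℝ => (1 + r * t ^ 2) ^ (-s)) =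
      fun t => (fun u : ℝ => (1 + u ^ 2) ^ (-s)) (√r * t) := by
    funext t
    simp only [mul_pow, Real.sq_sqrt hr.le]
  have hint' : Integrable (fun t : ℝ => (1 + r * t ^ 2) ^ (-s)) := by
    rw [hfun]
    exact hint.comp_mul_left' hsq.ne'
  have hval : ∫ t : ℝ, (1 + r * t ^ 2) ^ (-s) =
      r ^ (-(1 : ℝ) / 2) * ∫ t : ℝ, (1 + t ^ 2) ^ (-s) := by
    rw [hfun, Measure.integral_comp_mul_left (fun u : ℝ => (1 + u ^ 2) ^ (-s)), smul_eq_mul,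
      abs_of_pos (inv_pos.2 hsq),
      Real.sqrt_eq_rpow, ← Real.rpow_neg hr.le, neg_div]
  have hKpos : 0 < K := by rw [hK]; linarith
  have hterm : ∀ k : ℤ, (1 + r * ((k : ℝ) + x) ^ 2) ^ (-s) ≤
      K ^ s * ∫ t in (k : ℝ)..(k : ℝ) + 1, (1 + r * t ^ 2) ^ (-s) := by
    intro k
    have hconst : ∫ _ in (k : ℝ)..(k : ℝ) + 1, (K * (1 + r * ((k : ℝ) + x) ^ 2)) ^ (-s) =
        K ^ (-s) * (1 + r * ((k : ℝ) + x) ^ 2) ^ (-s) := by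
      rw [intervalIntegral.integral_const, Real.mul_rpow hKpos.le (by positivity)]
      simp
    have hle : K ^ (-s) * (1 + r * ((k : ℝ) + x) ^ 2) ^ (-s) ≤
        ∫ t in (k : ℝ)..(k : ℝ) + 1, (1 + r * t ^ 2) ^ (-s) := by
      rw [← hconst]
      refine intervalIntegral.integral_mono_on (by linarith) (by simp)
        hint'.intervalIntegrable fun t ht => ?_
      refine Real.rpow_le_rpow_of_nonpos (by positivity) ?_ (by linarith)
      obtain ⟨h1, h2⟩ := ht
      obtain ⟨h3, h4⟩ := abs_le.1 hx
      have ht2 : t ^ 2 ≤ 2 * ((k : ℝ) + x) ^ 2 + 5 := by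
        have h5 : (t - (k + x)) ^ 2 ≤ 9 / 4 := by nlinarith
        nlinarith [sq_nonneg (t - 2 * (k + x))]
      have h6 : r * t ^ 2 ≤ r * (2 * ((k : ℝ) + x) ^ 2 + 5) :=
        mul_le_mul_of_nonneg_left ht2 hr.le
      have h7 : 0 ≤ R * (r * ((k : ℝ) + x) ^ 2) := mul_nonneg (hr.le.trans hrR) (by positivity)
      rw [hK]
      nlinarith
    calc (1 + r * ((k : ℝ) + x) ^ 2) ^ (-s)
        = K ^ s * (K ^ (-s) * (1 + r * ((k : ℝ) + x) ^ 2) ^ (-s)) := by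
          rw [← mul_assoc, ← Real.rpow_add hKpos, add_neg_cancel, Real.rpow_zero, one_mul]
      _ ≤ _ := mul_le_mul_of_nonneg_left hle (by positivity)
  have hsum : HasSum (fun k : ℤ => ∫ t in (k : ℝ)..(k : ℝ) + 1, (1 + r * t ^ 2) ^ (-s))
      (∫ t : ℝ, (1 + r * t ^ 2) ^ (-s)) := by
    simpa using hint'.hasSum_intervalIntegral 0
  calc ∑ k ∈ F, (1 + r * ((k : ℝ) + x) ^ 2) ^ (-s)
      ≤ ∑ k ∈ F, K ^ s * ∫ t in (k : ℝ)..(k : ℝ) + 1, (1 + r * t ^ 2) ^ (-s) :=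
        Finset.sum_le_sum fun k _ => hterm k
    _ ≤ K ^ s * ∫ t : ℝ, (1 + r * t ^ 2) ^ (-s) := by
        rw [← Finset.mul_sum]
        refine mul_le_mul_of_nonneg_left (sum_le_hasSum F (fun k _ => ?_) hsum) (by positivity)
        exact intervalIntegral.integral_nonneg (by linarith) fun t _ => by positivity
    _ = _ := by rw [hval]; ring

/-- Finite sums of products of nonnegative functions of the coordinates are bounded by the
product of bounds for the finite sums in each coordinate. -/
theorem sum_prod_le_prod_of_sum_le {ι : Type*} [Fintype ι] [DecidableEq ι] {κ : Type*}
    [DecidableEq κ] (f : ι → κ → ℝ) (B : ι → ℝ) (hf : ∀ i k, 0 ≤ f i k)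
    (hB : ∀ i, ∀ F : Finset κ, ∑ k ∈ F, f i k ≤ B i) (S : Finset (ι → κ)) :
    ∑ m ∈ S, ∏ i, f i (m i) ≤ ∏ i, B i := by
  calc ∑ m ∈ S, ∏ i, f i (m i)
      ≤ ∑ m ∈ Fintype.piFinset fun i => S.image (fun m => m i), ∏ i, f i (m i) :=
        Finset.sum_le_sum_of_subset_of_nonneg
          (fun m hm => Fintype.mem_piFinset.2 fun i => Finset.mem_image_of_mem _ hm)
          fun m _ _ => Finset.prod_nonneg fun i _ => hf i _
    _ = ∏ i, ∑ k ∈ S.image (fun m => m i), f i k := (Finset.prod_univ_sum _ _).symm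
    _ ≤ ∏ i, B i := Finset.prod_le_prod
        (fun i _ => Finset.sum_nonneg fun k _ => hf i k) fun i _ => hB i _

theorem pow_mul_le_of_forall_mul_succ_le {n : ℕ} {q : ℝ} (hq : 0 ≤ q) (v : Fin n → ℝ)
    (hchain : ∀ i : Fin n, ∀ h : (i : ℕ) + 1 < n, q * v ⟨(i : ℕ) + 1, h⟩ ≤ v i)
    (hn : 0 < n) (k : ℕ) (hk : k < n) : q ^ k * v ⟨k, hk⟩ ≤ v ⟨0, hn⟩ := by
  induction k with
  | zero => simp
  | succ k ih =>
    calc q ^ (k + 1) * v ⟨k + 1, hk⟩ = q ^ k * (q * v ⟨k + 1, hk⟩) := by ring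
      _ ≤ q ^ k * v ⟨k, by omega⟩ :=
        mul_le_mul_of_nonneg_left (hchain ⟨k, by omega⟩ hk) (by positivity)
      _ ≤ _ := ih (by omega)

theorem one_add_sum_rpow_neg_le_prod {ι : Type*} [Fintype ι] {A : ℝ} (hA : 0 ≤ A)
    (hι : 0 < Fintype.card ι) (b : ι → ℝ) (hb : ∀ i, 0 ≤ b i) :
    (1 + ∑ i, b i) ^ (-A) ≤ ∏ i, (1 + b i) ^ (-(A / Fintype.card ι)) := by
  have hpos : 0 < 1 + ∑ i, b i := by
    have := Finset.sum_nonneg fun i (_ : i ∈ Finset.univ) => hb i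
    linarith
  have hι' : (0 : ℝ) < Fintype.card ι := by exact_mod_cast hι
  calc (1 + ∑ i, b i) ^ (-A) = ∏ _i : ι, (1 + ∑ i, b i) ^ (-(A / Fintype.card ι)) := by
        rw [Finset.prod_const, Finset.card_univ, ← Real.rpow_mul_natCast hpos.le]
        congr 1
        field_simp
    _ ≤ _ := by
        refine Finset.prod_le_prod (fun i _ => by positivity) fun i _ => ?_
        refine Real.rpow_le_rpow_of_nonpos (by linarith [hb i]) ?_
          (by have := div_nonneg hA hι'.le; linarith)
        have := Finset.single_le_sum (f := b) (fun j _ => hb j) (Finset.mem_univ i)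
        linarith

/-- tail estimate in the cusp asymptotics of theta functions.
Let `n ≥ 1`, `A > n/2`, `c > 0`.  Let `V = diag(v₁,…,vₙ)` with `vₙ ≥ √3/2` and
`v_j ≥ (3/4)v_{j+1}`, and let `Y` be symmetric positive definite with
`wYwᵀ ≥ c·wVwᵀ` for all `w`.  Then there is `C = C(n,A,c)`, independent of `V, Y, x`,
such that for every `x` with all entries of absolute value at most `1/2`:
`∑_{m ∈ ℤⁿ, m₁ ≠ 0} (1 + (m+x)Y(m+x)ᵀ)^{−A} ≤ C·(v₁⋯vₙ)^{−1/2}·(1+v₁)^{−A+n/2}`. -/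
theorem theta_tail_bound (n : ℕ) (hn : 0 < n) (A c : ℝ)
    (hA : (n : ℝ) / 2 < A) (hc : 0 < c) :
    ∃ C : ℝ,
      ∀ (v : Fin n → ℝ) (Y : Matrix (Fin n) (Fin n) ℝ) (x : Fin n → ℝ),
        (∀ i, 0 < v i) →
        Real.sqrt 3 / 2 ≤ v ⟨n - 1, by omega⟩ →
        (∀ i : Fin n, ∀ h : (i : ℕ) + 1 < n, (3 / 4 : ℝ) * v ⟨(i : ℕ) + 1, h⟩ ≤ v i) →
        Y.PosDef →
        (∀ w : Fin n → ℝ, c * (∑ i, v i * w i ^ 2) ≤ w ⬝ᵥ Y.mulVec w) →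
        (∀ i, |x i| ≤ 1 / 2) →
        ∑' m : {m : Fin n → ℤ // m ⟨0, hn⟩ ≠ 0},
            (1 + (fun i => ((m : Fin n → ℤ) i : ℝ) + x i) ⬝ᵥ
              Y.mulVec (fun i => ((m : Fin n → ℤ) i : ℝ) + x i)) ^ (-A)
          ≤ C * (∏ i, v i) ^ (-(1 : ℝ) / 2) * (1 + v ⟨0, hn⟩) ^ (-A + (n : ℝ) / 2) := by
  obtain ⟨C₁, hC₁⟩ := exists_sum_one_add_mul_sq_rpow_neg_le (A / n) (((3 / 4 : ℝ) ^ n)⁻¹) (by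
    have : (0 : ℝ) < n := by exact_mod_cast hn
    rw [lt_div_iff₀ this]
    linarith)
  have hn' : (0 : ℝ) < n := by exact_mod_cast hn
  have hA0 : 0 < A := by linarith
  set q : ℝ := (3 / 4 : ℝ) ^ n with hq
  have hq0 : 0 < q := by positivity
  have hq1 : q ≤ 1 := pow_le_one₀ (by norm_num) (by norm_num)
  refine ⟨(c / 8) ^ (-A) * |C₁| ^ n * (q / 4) ^ (-A + (n : ℝ) / 2), ?_⟩
  intro v Y x hv hlast hchain _ hYV hx
  set v₀ : ℝ := v ⟨0, hn⟩ with hv₀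
  have hv₀pos : 0 < v₀ := hv _
  have hqv : ∀ i, q * v i ≤ v₀ := by
    intro i
    refine le_trans ?_ (pow_mul_le_of_forall_mul_succ_le (by norm_num) v hchain hn i i.2)
    exact mul_le_mul_of_nonneg_right
      (pow_le_pow_of_le_one (by norm_num) (by norm_num) i.2.le) (hv i).le
  have hv₀q : q / 4 * (1 + v₀) ≤ v₀ := by
    have h3 : (1 : ℝ) ≤ √3 := Real.one_le_sqrt.2 (by norm_num)
    have h4 := hqv ⟨n - 1, by omega⟩
    have h5 : q * (1 / 2) ≤ v₀ := le_trans (mul_le_mul_of_nonneg_left (by linarith) hq0.le) h4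
    nlinarith
  have hterm : ∀ m : {m : Fin n → ℤ // m ⟨0, hn⟩ ≠ 0},
      (1 + (fun i => ((m : Fin n → ℤ) i : ℝ) + x i) ⬝ᵥ
        Y.mulVec (fun i => ((m : Fin n → ℤ) i : ℝ) + x i)) ^ (-A) ≤
      (c / 8 * v₀) ^ (-A) *
        ∏ i, (1 + v i / v₀ * (((m : Fin n → ℤ) i : ℝ) + x i) ^ 2) ^ (-(A / n)) := by
    rintro ⟨m, hm⟩
    have hY := hYV fun i => (m i : ℝ) + x i
    have hsingle := Finset.single_le_sum (f := fun i => v i * ((m i : ℝ) + x i) ^ 2)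
      (fun j _ => mul_nonneg (hv j).le (sq_nonneg _)) (Finset.mem_univ ⟨0, hn⟩)
    have hfirst : 1 / 4 ≤ ((m ⟨0, hn⟩ : ℝ) + x ⟨0, hn⟩) ^ 2 := by
      have h1 : (1 : ℝ) ≤ |(m ⟨0, hn⟩ : ℝ)| := by exact_mod_cast Int.one_le_abs hm
      have h2 := abs_sub_abs_le_abs_sub (m ⟨0, hn⟩ : ℝ) (-x ⟨0, hn⟩)
      rw [abs_neg, sub_neg_eq_add] at h2
      have h3 := hx ⟨0, hn⟩
      rw [← sq_abs]
      nlinarith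
    have hv4 : v₀ * (1 / 4) ≤ ∑ i, v i * ((m i : ℝ) + x i) ^ 2 :=
      (mul_le_mul_of_nonneg_left hfirst hv₀pos.le).trans hsingle
    have hsumeq : v₀ * ∑ i, v i / v₀ * ((m i : ℝ) + x i) ^ 2 =
        ∑ i, v i * ((m i : ℝ) + x i) ^ 2 := by
      rw [Finset.mul_sum]
      exact Finset.sum_congr rfl fun i _ => by field_simp
    have hb : ∀ i, 0 ≤ v i / v₀ * ((m i : ℝ) + x i) ^ 2 := fun i =>
      mul_nonneg (div_nonneg (hv i).le hv₀pos.le) (sq_nonneg _)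
    have hB := Finset.sum_nonneg fun i (_ : i ∈ Finset.univ) => hb i
    have hprod := one_add_sum_rpow_neg_le_prod hA0.le (by simpa using hn)
      (fun i => v i / v₀ * ((m i : ℝ) + x i) ^ 2) hb
    rw [Fintype.card_fin] at hprod
    refine le_trans ?_ (mul_le_mul_of_nonneg_left hprod (by positivity))
    rw [← Real.mul_rpow (by positivity) (by positivity)]
    refine Real.rpow_le_rpow_of_nonpos (by positivity) ?_ (by linarith)
    have hlow : c / 8 * v₀ * (1 + ∑ i, v i / v₀ * ((m i : ℝ) + x i) ^ 2) ≤
        c * ∑ i, v i * ((m i : ℝ) + x i) ^ 2 := by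
      rw [mul_assoc, mul_add, hsumeq]
      nlinarith
    linarith
  refine Real.tsum_le_of_sum_le (fun m => ?_) fun S => ?_
  · refine Real.rpow_nonneg ?_ _
    have h1 : 0 ≤ c * ∑ i, v i * (((m : Fin n → ℤ) i : ℝ) + x i) ^ 2 :=
      mul_nonneg hc.le (Finset.sum_nonneg fun i _ => mul_nonneg (hv i).le (sq_nonneg _))
    have h2 := hYV fun i => ((m : Fin n → ℤ) i : ℝ) + x i
    linarith
  have hsum : ∑ m ∈ S,
      ∏ i, (1 + v i / v₀ * (((m : Fin n → ℤ) i : ℝ) + x i) ^ 2) ^ (-(A / n)) ≤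
        ∏ i, |C₁| * (v i / v₀) ^ (-(1 : ℝ) / 2) := by
    have h := sum_prod_le_prod_of_sum_le
      (fun i (k : ℤ) => (1 + v i / v₀ * ((k : ℝ) + x i) ^ 2) ^ (-(A / n)))
      (fun i => |C₁| * (v i / v₀) ^ (-(1 : ℝ) / 2))
      (fun i k => Real.rpow_nonneg (by have := div_pos (hv i) hv₀pos; positivity) _)
      (fun i F => (hC₁ (v i / v₀) (x i) (div_pos (hv i) hv₀pos) (by
          rw [div_le_iff₀ hv₀pos, inv_mul_eq_div, le_div_iff₀ hq0, mul_comm]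
          exact hqv i) (hx i) F).trans
        (mul_le_mul_of_nonneg_right (le_abs_self _)
          (Real.rpow_nonneg (div_pos (hv i) hv₀pos).le _)))
      (S.map (Function.Embedding.subtype _))
    rwa [Finset.sum_map] at h
  have hprod : ∏ i, |C₁| * (v i / v₀) ^ (-(1 : ℝ) / 2) =
      |C₁| ^ n * ((∏ i, v i) ^ (-(1 : ℝ) / 2) * v₀ ^ ((n : ℝ) / 2)) := by
    rw [Finset.prod_mul_distrib, Finset.prod_const, Finset.card_univ, Fintype.card_fin,
      Real.finsetProd_rpow _ _ fun i _ => (div_pos (hv i) hv₀pos).le, Finset.prod_div_distrib,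
      Finset.prod_const, Finset.card_univ, Fintype.card_fin,
      Real.div_rpow (Finset.prod_nonneg fun i _ => (hv i).le) (by positivity),
      ← Real.rpow_natCast_mul hv₀pos.le, div_eq_mul_inv (_ ^ _) (_ ^ _),
      ← Real.rpow_neg hv₀pos.le]
    congr 3
    ring
  have hpow : v₀ ^ (-A + (n : ℝ) / 2) ≤
      (q / 4) ^ (-A + (n : ℝ) / 2) * (1 + v₀) ^ (-A + (n : ℝ) / 2) := by
    rw [← Real.mul_rpow (by positivity) (by positivity)]
    exact Real.rpow_le_rpow_of_nonpos (by positivity) hv₀q (by linarith)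
  have hP : 0 ≤ (∏ i, v i) ^ (-(1 : ℝ) / 2) :=
    Real.rpow_nonneg (Finset.prod_nonneg fun i _ => (hv i).le) _
  refine (Finset.sum_le_sum fun m _ => hterm m).trans ?_
  rw [← Finset.mul_sum]
  calc (c / 8 * v₀) ^ (-A) * _
      ≤ (c / 8 * v₀) ^ (-A) *
        (|C₁| ^ n * ((∏ i, v i) ^ (-(1 : ℝ) / 2) * v₀ ^ ((n : ℝ) / 2))) :=
        mul_le_mul_of_nonneg_left (hsum.trans_eq hprod) (by positivity)
    _ = (c / 8) ^ (-A) * |C₁| ^ n * (∏ i, v i) ^ (-(1 : ℝ) / 2) *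
        v₀ ^ (-A + (n : ℝ) / 2) := by
        rw [Real.mul_rpow (by positivity) hv₀pos.le, Real.rpow_add hv₀pos]
        ring
    _ ≤ (c / 8) ^ (-A) * |C₁| ^ n * (∏ i, v i) ^ (-(1 : ℝ) / 2) *
        ((q / 4) ^ (-A + (n : ℝ) / 2) * (1 + v₀) ^ (-A + (n : ℝ) / 2)) :=
        mul_le_mul_of_nonneg_left hpow (by positivity)
    _ = _ := by ring
end

section
/- For g ∈ Sp(n,ℝ), define D̂(g) = sup over γ ∈ Sp(n,ℤ) of det Y(γ g), where Y(h) = (C Cᵀ + D Dᵀ)^{−1} for h = ((A,B),(C,D)) ∈ Sp(n,ℝ) (the supremum is taken in (0,∞]). Then there exist constants 0 < c(n) ≤ C(n), depending only on n, such that for every g ∈ Sp(n,ℝ) and every real s with |s| ≤ 1: c(n) · D̂(g) ≤ D̂( g · diag(e^s I, e^{−s} I) ) ≤ C(n) · D̂(g), where diag(e^s I, e^{−s} I) denotes the 2n×2n block diagonal matrix with blocks e^s Iₙ and e^{−s} Iₙ. -/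
open Matrix

/-- The standard symplectic form `J₀ = ((0,−I),(I,0))`. -/
noncomputable def J0R (n : ℕ) : Matrix (Fin n ⊕ Fin n) (Fin n ⊕ Fin n) ℝ :=
  Matrix.fromBlocks 0 (-1) 1 0


/-- `det Y(h)` for `h = ((A,B),(C,D))`, where `Y(h) = (CCᵀ + DDᵀ)⁻¹`. -/
noncomputable def detY {n : ℕ} (h : Matrix (Fin n ⊕ Fin n) (Fin n ⊕ Fin n) ℝ) : ℝ :=
  ((h.toBlocks₂₁ * h.toBlocks₂₁ᵀ + h.toBlocks₂₂ * h.toBlocks₂₂ᵀ)⁻¹).det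

/-- The height function `D̂(g) = sup_{γ ∈ Sp(n,ℤ)} det Y(γg)`, valued in `(0,∞]`. -/
noncomputable def heightD (n : ℕ) (g : Matrix (Fin n ⊕ Fin n) (Fin n ⊕ Fin n) ℝ) : ENNReal :=
  ⨆ γ : {γ : Matrix (Fin n ⊕ Fin n) (Fin n ⊕ Fin n) ℤ //
      γ.map (Int.cast : ℤ → ℝ) * J0R n * (γ.map (Int.cast : ℤ → ℝ))ᵀ = J0R n},
    ENNReal.ofReal (detY ((γ : Matrix (Fin n ⊕ Fin n) (Fin n ⊕ Fin n) ℤ).map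
      (Int.cast : ℤ → ℝ) * g))

/-- A matrix of the form `1 + P` with `P` positive semidefinite has determinant at least one. -/
theorem Matrix.PosSemidef.one_le_det_one_add {ι : Type*} [Fintype ι] [DecidableEq ι]
    {P : Matrix ι ι ℝ} (hP : P.PosSemidef) : 1 ≤ (1 + P).det := by
  have h : (1 + P).det = ∏ i, (1 + hP.1.eigenvalues i) := by
    have h₁ := congrArg (Polynomial.eval (-1)) hP.1.charpoly_eq
    rw [Matrix.eval_charpoly, Polynomial.eval_prod] at h₁
    have h₂ : 1 + P = -(Matrix.scalar ι (-1 : ℝ) - P) := by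
      ext i j
      by_cases hij : i = j <;> simp [hij, add_comm]
    rw [h₂, Matrix.det_neg, h₁, ← Finset.card_univ, ← Finset.prod_const, ← Finset.prod_mul_distrib]
    exact Finset.prod_congr rfl fun i _ => by simp; ring
  rw [h]
  exact Finset.one_le_prod fun i _ => by linarith [hP.eigenvalues_nonneg i]

open scoped MatrixOrder in
/-- The determinant is monotone on positive semidefinite real matrices. -/
theorem Matrix.PosSemidef.det_le_det_add {ι : Type*} [Fintype ι] [DecidableEq ι]
    {A B : Matrix ι ι ℝ} (hA : A.PosSemidef) (hB : B.PosSemidef) : A.det ≤ (A + B).det := by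
  by_cases h : A.det = 0
  · exact h ▸ (hA.add hB).det_nonneg
  have hsqrt : (CFC.sqrt B).IsHermitian := (CFC.sqrt_nonneg B).posSemidef.1
  rw [← CFC.sqrt_mul_sqrt_self B hB.nonneg, Matrix.det_add_mul _ _ (Ne.isUnit h)]
  refine le_mul_of_one_le_right hA.det_nonneg ?_
  have h := hA.inv.mul_mul_conjTranspose_same (CFC.sqrt B)
  rw [hsqrt.eq] at h
  exact h.one_le_det_one_add

theorem Matrix.posSemidef_self_mul_transpose {m k : Type*} [Fintype m] [Fintype k]
    (A : Matrix m k ℝ) : (A * Aᵀ).PosSemidef := by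
  simpa using Matrix.posSemidef_self_mul_conjTranspose A

theorem detY_eq_inv {n : ℕ} (h : Matrix (Fin n ⊕ Fin n) (Fin n ⊕ Fin n) ℝ) :
    detY h = ((h.toBlocks₂₁ * h.toBlocks₂₁ᵀ + h.toBlocks₂₂ * h.toBlocks₂₂ᵀ).det)⁻¹ := by
  rw [detY, Matrix.det_nonsing_inv, Ring.inverse_eq_inv']

/-- The time-`s` geodesic flow element `diag(eˢI, e⁻ˢI)`. -/
noncomputable def flowMatrix (n : ℕ) (s : ℝ) : Matrix (Fin n ⊕ Fin n) (Fin n ⊕ Fin n) ℝ :=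
  Matrix.fromBlocks (Real.exp s • 1) 0 0 (Real.exp (-s) • 1)

theorem flowMatrix_mul_neg (n : ℕ) (s : ℝ) : flowMatrix n s * flowMatrix n (-s) = 1 := by
  simp [flowMatrix, Matrix.fromBlocks_multiply, smul_smul, ← Real.exp_add]

theorem toBlocks₂₁_mul_flowMatrix {n : ℕ} (h : Matrix (Fin n ⊕ Fin n) (Fin n ⊕ Fin n) ℝ) (s : ℝ) :
    (h * flowMatrix n s).toBlocks₂₁ = Real.exp s • h.toBlocks₂₁ := by
  conv_lhs => rw [← Matrix.fromBlocks_toBlocks h]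
  simp [flowMatrix, Matrix.fromBlocks_multiply]

theorem toBlocks₂₂_mul_flowMatrix {n : ℕ} (h : Matrix (Fin n ⊕ Fin n) (Fin n ⊕ Fin n) ℝ) (s : ℝ) :
    (h * flowMatrix n s).toBlocks₂₂ = Real.exp (-s) • h.toBlocks₂₂ := by
  conv_lhs => rw [← Matrix.fromBlocks_toBlocks h]
  simp [flowMatrix, Matrix.fromBlocks_multiply]

theorem detY_mul_flowMatrix_le {n : ℕ} (h : Matrix (Fin n ⊕ Fin n) (Fin n ⊕ Fin n) ℝ) {s : ℝ}
    (hs : |s| ≤ 1) : detY (h * flowMatrix n s) ≤ Real.exp 2 ^ n * detY h := by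
  obtain ⟨hs₁, hs₂⟩ := abs_le.mp hs
  rw [detY_eq_inv, detY_eq_inv, toBlocks₂₁_mul_flowMatrix, toBlocks₂₂_mul_flowMatrix]
  set C := h.toBlocks₂₁
  set D := h.toBlocks₂₂
  have hM := (Matrix.posSemidef_self_mul_transpose C).add (Matrix.posSemidef_self_mul_transpose D)
  have hMs := (Matrix.posSemidef_self_mul_transpose (Real.exp s • C)).add
    (Matrix.posSemidef_self_mul_transpose (Real.exp (-s) • D))
  set M := C * Cᵀ + D * Dᵀ with hM_def
  set Ms := (Real.exp s • C) * (Real.exp s • C)ᵀ + (Real.exp (-s) • D) * (Real.exp (-s) • D)ᵀ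
    with hMs_def
  have pos (t : ℝ) (ht : -1 ≤ t) : 0 ≤ Real.exp 2 * (Real.exp t * Real.exp t) - 1 := by
    rw [← Real.exp_add, ← Real.exp_add, sub_nonneg]
    exact Real.one_le_exp (by linarith)
  have upper : M.det ≤ Real.exp 2 ^ n * Ms.det := by
    have key := hM.det_le_det_add
      (((Matrix.posSemidef_self_mul_transpose C).smul (pos s hs₁)).add
        ((Matrix.posSemidef_self_mul_transpose D).smul (pos (-s) (by linarith))))
    have e : M + ((Real.exp 2 * (Real.exp s * Real.exp s) - 1) • (C * Cᵀ) +
        (Real.exp 2 * (Real.exp (-s) * Real.exp (-s)) - 1) • (D * Dᵀ)) = Real.exp 2 • Ms := by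
      simp only [hM_def, hMs_def, Matrix.transpose_smul, Matrix.smul_mul, Matrix.mul_smul]
      module
    rwa [e, Matrix.det_smul, Fintype.card_fin] at key
  have lower : Ms.det ≤ Real.exp 2 ^ n * M.det := by
    have pos' (t : ℝ) (ht : t ≤ 1) : 0 ≤ Real.exp 2 - Real.exp t * Real.exp t := by
      rw [← Real.exp_add, sub_nonneg]
      exact Real.exp_le_exp.mpr (by linarith)
    have key := hMs.det_le_det_add
      (((Matrix.posSemidef_self_mul_transpose C).smul (pos' s hs₂)).add
        ((Matrix.posSemidef_self_mul_transpose D).smul (pos' (-s) (by linarith))))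
    have e : Ms + ((Real.exp 2 - Real.exp s * Real.exp s) • (C * Cᵀ) +
        (Real.exp 2 - Real.exp (-s) * Real.exp (-s)) • (D * Dᵀ)) = Real.exp 2 • M := by
      simp only [hM_def, hMs_def, Matrix.transpose_smul, Matrix.smul_mul, Matrix.mul_smul]
      module
    rwa [e, Matrix.det_smul, Fintype.card_fin] at key
  have hK : 0 < Real.exp 2 ^ n := by positivity
  rcases hM.det_nonneg.eq_or_lt with h₀ | h₀
  · rw [← h₀, mul_zero] at lower
    simp [← h₀, le_antisymm lower hMs.det_nonneg]
  · have h₁ : 0 < Ms.det := pos_of_mul_pos_right (h₀.trans_le upper) hK.le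
    rw [← div_eq_mul_inv, inv_le_iff_one_le_mul₀ h₁, div_mul_eq_mul_div, le_div_iff₀ h₀, one_mul]
    exact upper

theorem heightD_mul_flowMatrix_le (n : ℕ) (g : Matrix (Fin n ⊕ Fin n) (Fin n ⊕ Fin n) ℝ) {s : ℝ}
    (hs : |s| ≤ 1) :
    heightD n (g * flowMatrix n s) ≤ ENNReal.ofReal (Real.exp 2 ^ n) * heightD n g := by
  rw [heightD, heightD, ENNReal.mul_iSup]
  refine iSup_mono fun γ => ?_
  rw [← ENNReal.ofReal_mul (by positivity), ← Matrix.mul_assoc]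
  exact ENNReal.ofReal_le_ofReal (detY_mul_flowMatrix_le _ hs)

/-- quasi-invariance of the height under the geodesic flow, Lemma 5.2.
There are constants `0 < c(n) ≤ C(n)` such that for all `g ∈ Sp(n,ℝ)` and `|s| ≤ 1`:
`c(n)·D̂(g) ≤ D̂(g·diag(eˢI, e⁻ˢI)) ≤ C(n)·D̂(g)`. -/
theorem height_flow_comparison (n : ℕ) :
    ∃ c C : ℝ, 0 < c ∧ c ≤ C ∧
      ∀ g : Matrix (Fin n ⊕ Fin n) (Fin n ⊕ Fin n) ℝ,
        g * J0R n * gᵀ = J0R n →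
        ∀ s : ℝ, |s| ≤ 1 →
          ENNReal.ofReal c * heightD n g ≤
            heightD n (g * Matrix.fromBlocks (Real.exp s • 1) 0 0 (Real.exp (-s) • 1)) ∧
          heightD n (g * Matrix.fromBlocks (Real.exp s • 1) 0 0 (Real.exp (-s) • 1)) ≤
            ENNReal.ofReal C * heightD n g := by
  have hK : 1 ≤ Real.exp 2 ^ n := one_le_pow₀ (Real.one_le_exp (by norm_num))
  have hK₀ : 0 < Real.exp 2 ^ n := by positivity
  refine ⟨(Real.exp 2 ^ n)⁻¹, Real.exp 2 ^ n, by positivity,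
    (inv_le_one_of_one_le₀ hK).trans hK, fun g _ s hs =>
      ⟨?_, heightD_mul_flowMatrix_le n g hs⟩⟩
  have h := heightD_mul_flowMatrix_le n (g * flowMatrix n s) (s := -s) (by rwa [abs_neg])
  rw [Matrix.mul_assoc, flowMatrix_mul_neg, Matrix.mul_one] at h
  calc ENNReal.ofReal (Real.exp 2 ^ n)⁻¹ * heightD n g
      ≤ ENNReal.ofReal (Real.exp 2 ^ n)⁻¹ *
          (ENNReal.ofReal (Real.exp 2 ^ n) * heightD n (g * flowMatrix n s)) := by gcongr
    _ = heightD n (g * flowMatrix n s) := by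
      rw [← mul_assoc, ← ENNReal.ofReal_mul (by positivity), inv_mul_cancel₀ hK₀.ne',
        ENNReal.ofReal_one, one_mul]
end
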